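/- Let G_n be a high degree almost balanced sequence of simple connected graphs with parameters d_n → ∞ and K > 1, such that the local limit of the uniform spanning tree UST(G_n) exists. If β_n ≪ d_n, then the local limit of WST^{β_n}(G_n) exists and equals the local limit of UST(G_n). -/

import Mathlib

open MeasureTheory Filter Finset

noncomputable section

set_option linter.unusedSectionVars false

namespace WSTPaper

variable {V : Type} [Fintype V] [DecidableEq V]

open scoped Classical in
/-- The edge sets of spanning trees of `G`. -/
def spanningTrees (G : SimpleGraph V) : Finset (Finset (Sym2 V)) :=
  Finset.univ.filter
    (fun T => ↑T ⊆ G.edgeSet ∧ (SimpleGraph.fromEdgeSet (↑T : Set (Sym2 V))).IsTree)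

/-- Weight of a spanning tree: product of its edge conductances. -/
def treeWeight (c : Sym2 V → ℝ) (T : Finset (Sym2 V)) : ℝ := ∏ e ∈ T, c e

/-- Partition function of the weighted spanning tree measure. -/
def partZ (G : SimpleGraph V) (c : Sym2 V → ℝ) : ℝ := ∑ T ∈ spanningTrees G, treeWeight c T

/-- The ball of radius `r` around `x` in `G` (w.r.t. the graph distance), as a set of vertices. -/
def ballSet (G : SimpleGraph V) (x : V) (r : ℕ) : Set V :=
  {y | G.Reachable x y ∧ G.dist x y ≤ r}

lemma mem_ballSet_self (G : SimpleGraph V) (x : V) (r : ℕ) : x ∈ ballSet G x r :=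
  ⟨SimpleGraph.Reachable.refl x, by simp [SimpleGraph.dist_self]⟩

/-- The `r`-ball of `G` around `x` is rooted-isomorphic to the rooted graph `(H, w)`. -/
def BallIso (G : SimpleGraph V) (x : V) (r : ℕ) {W : Type} (H : SimpleGraph W) (w : W) : Prop :=
  ∃ φ : SimpleGraph.induce (ballSet G x r) G ≃g H, φ ⟨x, mem_ballSet_self G x r⟩ = w

open scoped Classical in
/-- `P(B_{WST(c)}(X, r) ≅ (H, w))`, where `X` is a uniform random vertex of `G`. -/
def wstBallProb (G : SimpleGraph V) (c : Sym2 V → ℝ) (r : ℕ)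
    {W : Type} (H : SimpleGraph W) (w : W) : ℝ :=
  (Fintype.card V : ℝ)⁻¹ *
    ∑ x : V, (∑ T ∈ spanningTrees G,
      if BallIso (SimpleGraph.fromEdgeSet (↑T : Set (Sym2 V))) x r H w then treeWeight c T else 0)
      / partZ G c

/-- Product of i.i.d. Uniform[0,1] label measures, one label for each (potential) edge. -/
def labelMeasure (ι : Type) [Fintype ι] : Measure (ι → ℝ) :=
  Measure.pi fun _ => (volume.restrict (Set.Icc (0:ℝ) 1))

/-- `P(B_{WST^β(G)}(X, r) ≅ (H, w))`: the annealed ball probability for the weighted spanning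
tree in the random environment of conductances `c_β(e) = exp(-β U_e)` with i.i.d. `U_e ~ U[0,1]`. -/
def wstBetaBallProb (G : SimpleGraph V) (β : ℝ) (r : ℕ)
    {W : Type} (H : SimpleGraph W) (w : W) : ℝ :=
  ∫ u : Sym2 V → ℝ,
    wstBallProb G (fun e => Real.exp (-β * u e)) r H w ∂(labelMeasure (Sym2 V))

section NegAssoc
variable {ι E : Type*} [Fintype ι] [DecidableEq E]

/-- Total weight of the sets of a weighted family that contain `I` and avoid `O`. -/
def condSum (S : ι → Finset E) (w : ι → ℝ) (I O : Finset E) : ℝ :=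
  ∑ i, if I ⊆ S i ∧ Disjoint O (S i) then w i else 0

lemma condSum_nonneg {S : ι → Finset E} {w : ι → ℝ} (hw : ∀ i, 0 ≤ w i) (I O : Finset E) :
    0 ≤ condSum S w I O :=
  Finset.sum_nonneg fun i _ => by split_ifs <;> simp [hw]

lemma condSum_split (S : ι → Finset E) (w : ι → ℝ) (I O : Finset E) (f : E) :
    condSum S w I O = condSum S w (insert f I) O + condSum S w I (insert f O) := by
  unfold condSum
  rw [← Finset.sum_add_distrib]
  refine Finset.sum_congr rfl fun i _ => ?_
  by_cases hf : f ∈ S i <;> simp [Finset.insert_subset_iff, Finset.disjoint_insert_left, hf]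

lemma condSum_eq_zero_of_mem {S : ι → Finset E} {w : ι → ℝ} {I O : Finset E} {e : E}
    (hI : e ∈ I) (hO : e ∈ O) : condSum S w I O = 0 := by
  refine Finset.sum_eq_zero fun i _ => if_neg ?_
  rintro ⟨h1, h2⟩
  exact Finset.disjoint_left.1 h2 hO (h1 hI)

lemma condSum_mul_eq_zero {S : ι → Finset E} {w : ι → ℝ} (hw : ∀ i, 0 ≤ w i) (g : ι → ℝ)
    {I O : Finset E} (h : condSum S w I O = 0) : condSum S (fun i => w i * g i) I O = 0 := by
  unfold condSum at h ⊢
  rw [Finset.sum_eq_zero_iff_of_nonneg (fun i _ => by split_ifs <;> simp [hw])] at h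
  refine Finset.sum_eq_zero fun i hi => ?_
  have := h i hi
  split_ifs with hc
  · rw [if_pos hc] at this; simp [this]
  · rfl

/-- Pairwise negative correlation under every conditioning. -/
def NegCorr (S : ι → Finset E) (w : ι → ℝ) : Prop :=
  ∀ I O : Finset E, ∀ e f : E, e ≠ f →
    condSum S w (insert f (insert e I)) O * condSum S w I (insert f (insert e O)) ≤
      condSum S w (insert e I) (insert f O) * condSum S w (insert f I) (insert e O)

lemma sum_condSum_insert [Fintype E] (S : ι → Finset E) (w : ι → ℝ) {r : ℕ}
    (hr : ∀ i, (S i).card = r) (I O : Finset E) :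
    ∑ f ∈ univ \ I, condSum S w (insert f I) O = ((r : ℝ) - I.card) * condSum S w I O := by
  unfold condSum
  rw [Finset.sum_comm, Finset.mul_sum]
  refine Finset.sum_congr rfl fun i _ => ?_
  by_cases h : I ⊆ S i ∧ Disjoint O (S i)
  · rw [if_pos h]
    simp only [Finset.insert_subset_iff, h.1, h.2, and_true]
    rw [← Finset.sum_filter, Finset.sum_const, nsmul_eq_mul]
    congr 1
    have : (univ \ I).filter (fun f => f ∈ S i) = S i \ I := by ext; simp [and_comm]
    rw [this, Finset.card_sdiff_of_subset h.1, hr, Nat.cast_sub]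
    rw [← hr i]; exact Finset.card_le_card h.1
  · rw [if_neg h, mul_zero]
    refine Finset.sum_eq_zero fun f _ => if_neg ?_
    rintro ⟨h1, h2⟩
    exact h ⟨(Finset.subset_insert _ _).trans h1, h2⟩

/-- Negative association between a single element and a monotone function
(Feder–Mihail). -/
theorem negAssoc_insert [Fintype E] {S : ι → Finset E} {w : ι → ℝ} (hw : ∀ i, 0 ≤ w i) {r : ℕ}
    (hr : ∀ i, (S i).card = r) (hS : NegCorr S w) {g : Finset E → ℝ} (hg : Monotone g) {e : E}
    (he : ∀ A, g (insert e A) = g A) (I O : Finset E) :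
    condSum S (fun i => w i * g (S i)) (insert e I) O * condSum S w I (insert e O) ≤
      condSum S (fun i => w i * g (S i)) I (insert e O) * condSum S w (insert e I) O := by
  induction hk : (univ \ (I ∪ O)).card using Nat.strong_induction_on generalizing I O with
  | _ k ih =>
  set G := condSum S (fun i => w i * g (S i)) with hG
  set Z := condSum S w with hZ
  have Z0 : ∀ I O, 0 ≤ Z I O := condSum_nonneg hw
  have GZ : ∀ I O, Z I O = 0 → G I O = 0 := fun I O h => condSum_mul_eq_zero hw _ h
  by_cases heO : e ∈ O
  · have h1 : Z (insert e I) O = 0 := condSum_eq_zero_of_mem (mem_insert_self _ _) heO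
    rw [h1, GZ _ _ h1]; simp
  by_cases heI : e ∈ I
  · have h1 : Z I (insert e O) = 0 := condSum_eq_zero_of_mem heI (mem_insert_self _ _)
    rw [h1, GZ _ _ h1]; simp
  by_cases hbase : ∀ f, f ∉ insert e I → Z (insert f (insert e I)) O = 0
  · -- every contributing set equals `insert e I`
    have h1 : G (insert e I) O = g I * Z (insert e I) O := by
      rw [hG, hZ]; unfold condSum
      rw [Finset.mul_sum]
      refine Finset.sum_congr rfl fun i hi => ?_
      split_ifs with hc
      · by_cases hsub : S i = insert e I
        · simp only [hsub, he]; ring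
        · obtain ⟨f, hf, hf'⟩ : ∃ f ∈ S i, f ∉ insert e I := by
            by_contra! hcon
            exact hsub (Finset.Subset.antisymm hcon hc.1)
          have h2 := hbase f hf'
          rw [hZ] at h2; unfold condSum at h2
          rw [Finset.sum_eq_zero_iff_of_nonneg (fun i _ => by split_ifs <;> simp [hw])] at h2
          have h3 := h2 i hi
          rw [if_pos ⟨Finset.insert_subset hf hc.1, hc.2⟩] at h3
          simp [h3]
      · simp
    have h2 : g I * Z I (insert e O) ≤ G I (insert e O) := by
      rw [hG, hZ]; unfold condSum
      rw [Finset.mul_sum]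
      refine Finset.sum_le_sum fun i hi => ?_
      split_ifs with hc
      · rw [mul_comm]; exact mul_le_mul_of_nonneg_left (hg hc.1) (hw i)
      · simp
    rw [h1]
    nlinarith [Z0 (insert e I) O]
  · push Not at hbase
    obtain ⟨f₀, hf₀, hf₀Z⟩ := hbase
    obtain ⟨f, hf, hfpos, hfG⟩ : ∃ f, f ∉ insert e I ∧ 0 < Z (insert f (insert e I)) O ∧
        Z (insert f (insert e I)) O * G (insert e I) O ≤
          G (insert f (insert e I)) O * Z (insert e I) O := by
      by_contra! hcon
      have hsum : ∑ f ∈ univ \ insert e I, (G (insert f (insert e I)) O * Z (insert e I) O -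
          Z (insert f (insert e I)) O * G (insert e I) O) = 0 := by
        rw [Finset.sum_sub_distrib, ← Finset.sum_mul, ← Finset.sum_mul, hG, hZ,
          sum_condSum_insert S _ hr, sum_condSum_insert S _ hr]
        ring
      have hle : ∀ f ∈ univ \ insert e I, (G (insert f (insert e I)) O * Z (insert e I) O -
          Z (insert f (insert e I)) O * G (insert e I) O) ≤ 0 := by
        intro f hf
        rcases (Z0 (insert f (insert e I)) O).lt_or_eq with h | h
        · linarith [hcon f (by simpa using hf) h]
        · rw [GZ _ _ h.symm, ← h]; simp
      have := (Finset.sum_eq_zero_iff_of_nonpos hle).1 hsum f₀ (by simpa using hf₀)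
      linarith [hcon f₀ hf₀ (lt_of_le_of_ne (Z0 _ _) (Ne.symm hf₀Z))]
    simp only [mem_insert, not_or] at hf
    have hfO : f ∉ O := fun h => hfpos.ne'
      (condSum_eq_zero_of_mem (mem_insert_self _ _) h)
    have hlt1 : (univ \ (insert f I ∪ O)).card < k := by
      rw [← hk]
      refine Finset.card_lt_card ⟨?_, ?_⟩
      · intro x; simp
      · intro h
        have := @h f (by simp [hf.2, hfO])
        simp at this
    have hlt2 : (univ \ (I ∪ insert f O)).card < k := by
      rw [← hk]
      refine Finset.card_lt_card ⟨?_, ?_⟩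
      · intro x; simp
      · intro h
        have := @h f (by simp [hf.2, hfO])
        simp at this
    have ih1 := ih _ hlt1 (insert f I) O rfl
    have ih2 := ih _ hlt2 I (insert f O) rfl
    have nc := hS I O e f (Ne.symm hf.1)
    have s1 := condSum_split S w (insert e I) O f
    have s2 := condSum_split S w I (insert e O) f
    have s3 := condSum_split S (fun i => w i * g (S i)) (insert e I) O f
    have s4 := condSum_split S (fun i => w i * g (S i)) I (insert e O) f
    rw [Finset.insert_comm e f I] at ih1
    rw [Finset.insert_comm e f O] at ih2
    simp only [← hG, ← hZ] at ih1 ih2 nc s1 s2 s3 s4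
    rw [s1, s3] at hfG
    rw [s1, s2, s3, s4]
    have gb := GZ (insert e I) (insert f O)
    have gc := GZ (insert f I) (insert e O)
    have gd := GZ I (insert f (insert e O))
    have b0 := Z0 (insert e I) (insert f O)
    have c0 := Z0 (insert f I) (insert e O)
    have d0 := Z0 I (insert f (insert e O))
    revert ih1 ih2 nc hfG gb gc gd b0 c0 d0 hfpos
    generalize Z (insert f (insert e I)) O = a
    generalize Z (insert e I) (insert f O) = b
    generalize Z (insert f I) (insert e O) = c
    generalize Z I (insert f (insert e O)) = d
    generalize G (insert f (insert e I)) O = A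
    generalize G (insert e I) (insert f O) = B
    generalize G (insert f I) (insert e O) = C
    generalize G I (insert f (insert e O)) = D
    intro a0 hfG ih1 ih2 nc gb gc gd b0 c0 d0
    have hAB : B * a ≤ A * b := by nlinarith
    rcases b0.lt_or_eq with b0 | b0
    · rcases d0.lt_or_eq with d0 | d0
      · have c0 : 0 < c := by
          by_contra h
          have : c = 0 := le_antisymm (not_lt.1 h) c0
          subst this; nlinarith [mul_pos a0 d0]
        obtain ⟨α, rfl⟩ : ∃ α, A = α * a := ⟨A / a, by field_simp⟩
        obtain ⟨β, rfl⟩ : ∃ β, B = β * b := ⟨B / b, by field_simp⟩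
        obtain ⟨γ, rfl⟩ : ∃ γ, C = γ * c := ⟨C / c, by field_simp⟩
        obtain ⟨δ, rfl⟩ : ∃ δ, D = δ * d := ⟨D / d, by field_simp⟩
        have h1 : α ≤ γ := by
          have := mul_pos a0 c0
          by_contra h; push Not at h; nlinarith
        have h2 : β ≤ δ := by
          have := mul_pos b0 d0
          by_contra h; push Not at h; nlinarith
        have h3 : β ≤ α := by
          have := mul_pos a0 b0
          by_contra h; push Not at h; nlinarith
        have e1 : 0 ≤ (γ - α) * (c * (a + b)) := mul_nonneg (by linarith) (by positivity)
        have e2 : 0 ≤ (δ - β) * (d * (a + b)) := mul_nonneg (by linarith) (by positivity)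
        have e3 : 0 ≤ (α - β) * (b * c - a * d) := mul_nonneg (by linarith) (by linarith)
        nlinarith
      · have hD := gd d0.symm
        subst d0; subst hD
        have h1 : B * c ≤ C * b := by
          have h2 : B * c * a ≤ C * b * a := by
            nlinarith [mul_le_mul_of_nonneg_right hAB c0, mul_le_mul_of_nonneg_right ih1 b0.le]
          exact le_of_mul_le_mul_right h2 a0
        nlinarith
    · have hB := gb b0.symm
      subst b0; subst hB
      have hd : d = 0 := by
        by_contra h
        have : 0 < d := lt_of_le_of_ne d0 (Ne.symm h)
        nlinarith [mul_pos a0 this]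
      have hD := gd hd
      subst hd; subst hD
      nlinarith

/-- Deleting a set of elements on which `g` does not depend increases the mean of `g`. -/
theorem condSum_delete_le [Fintype E] {S : ι → Finset E} {w : ι → ℝ} (hw : ∀ i, 0 ≤ w i) {r : ℕ}
    (hr : ∀ i, (S i).card = r) (hS : NegCorr S w) {g : Finset E → ℝ} (hg : Monotone g)
    (O : Finset E) (hO : ∀ e ∈ O, ∀ A, g (insert e A) = g A) (hpos : 0 < condSum S w ∅ O) :
    condSum S (fun i => w i * g (S i)) ∅ ∅ * condSum S w ∅ O ≤
      condSum S (fun i => w i * g (S i)) ∅ O * condSum S w ∅ ∅ := by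
  induction O using Finset.induction_on with
  | empty => rfl
  | insert e O heO ih =>
    have s1 := condSum_split S w ∅ O e
    have s2 := condSum_split S (fun i => w i * g (S i)) ∅ O e
    have h0 := condSum_nonneg hw (S := S) (insert e ∅) O
    have h00 := condSum_nonneg hw (S := S) ∅ ∅
    have hOpos : 0 < condSum S w ∅ O := by linarith
    have ih := ih (fun e' he' => hO e' (mem_insert_of_mem he')) hOpos
    have key := negAssoc_insert hw hr hS hg (hO e (mem_insert_self _ _)) ∅ O
    have step : condSum S (fun i => w i * g (S i)) ∅ O * condSum S w ∅ (insert e O) ≤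
        condSum S (fun i => w i * g (S i)) ∅ (insert e O) * condSum S w ∅ O := by
      rw [s1, s2]; linarith
    refine le_of_mul_le_mul_right (a := condSum S w ∅ O) ?_ hOpos
    calc _ = condSum S (fun i => w i * g (S i)) ∅ ∅ * condSum S w ∅ O
              * condSum S w ∅ (insert e O) := by ring
      _ ≤ condSum S (fun i => w i * g (S i)) ∅ O * condSum S w ∅ ∅
              * condSum S w ∅ (insert e O) := mul_le_mul_of_nonneg_right ih hpos.le
      _ = condSum S (fun i => w i * g (S i)) ∅ O * condSum S w ∅ (insert e O)
              * condSum S w ∅ ∅ := by ring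
      _ ≤ condSum S (fun i => w i * g (S i)) ∅ (insert e O) * condSum S w ∅ O
              * condSum S w ∅ ∅ := mul_le_mul_of_nonneg_right step h00
      _ = _ := by ring

end NegAssoc

/-- A map `V → Option V` without cycles: every orbit is eventually killed. -/
def Acyc (π : V → Option V) : Prop := ∃ rk : V → ℕ, ∀ v u, π v = some u → rk u < rk v

lemma exists_trapped_of_not_acyc {π : V → Option V} (h : ¬ Acyc π) :
    ∃ N : Set V, N.Nonempty ∧ ∀ v, v ∈ N ↔ ∃ u ∈ N, π v = some u := by
  let it : ℕ → V → Option V := fun j v => (fun o : Option V => o.bind π)^[j] (some v)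
  have itn : ∀ j v u, π v = some u → it (j + 1) v = it j u := by
    intro j v u hu
    simp only [it, Function.iterate_succ_apply]
    simp [hu]
  refine ⟨{v | ∀ j, it j v ≠ none}, ?_, ?_⟩
  · by_contra hne
    rw [Set.not_nonempty_iff_eq_empty, Set.eq_empty_iff_forall_notMem] at hne
    have hne : ∀ v, ∃ j, it j v = none := by simpa using hne
    classical
    refine h ⟨fun v => Nat.find (hne v), fun v u hu => ?_⟩
    have h1 := Nat.find_spec (hne v)
    rcases hk : Nat.find (hne v) with _ | k
    · rw [hk] at h1; simp [it] at h1
    · rw [hk, itn k v u hu] at h1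
      change Nat.find (hne u) < Nat.find (hne v)
      rw [hk]
      exact Nat.lt_succ_of_le (Nat.find_min' (hne u) h1)
  · intro v
    constructor
    · intro hv
      rcases hu : π v with _ | u
      · exact absurd (by simp [it, hu]) (hv 1)
      · exact ⟨u, fun j => by rw [← itn j v u hu]; exact hv _, rfl⟩
    · rintro ⟨u, hu, hvu⟩ (_ | j)
      · simp [it]
      · rw [itn j v u hvu]; exact hu j

/-- The matrix whose rows are `δ_v - δ_{π v}`. -/
def stepMatrix (π : V → Option V) : Matrix V V ℝ :=
  Matrix.of fun v u => (if v = u then 1 else 0) - (if π v = some u then 1 else 0)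

lemma det_stepMatrix_of_acyc {π : V → Option V} (h : Acyc π) : (stepMatrix π).det = 1 := by
  obtain ⟨rk, hrk⟩ := h
  have hb : (stepMatrix π).BlockTriangular (fun v => OrderDual.toDual (rk v)) := by
    intro i j hij
    have hij : rk i < rk j := hij
    have h1 : i ≠ j := by rintro rfl; exact lt_irrefl _ hij
    have h2 : π i ≠ some j := fun h => by have := hrk _ _ h; omega
    simp [stepMatrix, h1, h2]
  rw [hb.det]
  refine Finset.prod_eq_one fun a _ => ?_
  have : (stepMatrix π).toSquareBlock (fun v => OrderDual.toDual (rk v)) a = 1 := by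
    ext ⟨i, hi⟩ ⟨j, hj⟩
    have h2 : π i ≠ some j := fun h => by
      have := hrk _ _ h
      have h3 : rk i = rk j := OrderDual.toDual.injective (hi.trans hj.symm)
      omega
    simp [stepMatrix, Matrix.toSquareBlock_def, h2, Matrix.one_apply]
  rw [this, Matrix.det_one]

lemma det_stepMatrix_of_not_acyc {π : V → Option V} (h : ¬ Acyc π) : (stepMatrix π).det = 0 := by
  classical
  obtain ⟨N, ⟨v₀, hv₀⟩, hN⟩ := exists_trapped_of_not_acyc h
  refine Matrix.exists_mulVec_eq_zero_iff.1 ⟨fun v => if v ∈ N then 1 else 0, ?_, ?_⟩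
  · intro h0
    have := congrFun h0 v₀
    simp [hv₀] at this
  · ext v
    simp only [Matrix.mulVec, dotProduct, stepMatrix, Matrix.of_apply, sub_mul, ite_mul, one_mul,
      zero_mul, Finset.sum_sub_distrib, Finset.sum_ite_eq, Finset.mem_univ, if_true,
      Pi.zero_apply]
    rcases hu : π v with _ | u
    · have : v ∉ N := by rw [hN]; simp [hu]
      simp [this]
    · have : v ∈ N ↔ u ∈ N := by rw [hN]; simp [hu]
      simp [this]

/-- The Laplacian of a directed weighting `W` with killing `W v none`. -/
def killedLap (W : V → Option V → ℝ) : Matrix V V ℝ :=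
  Matrix.of fun v u => (if v = u then ∑ o, W v o else 0) - W v (some u)

open scoped Classical in
/-- The directed matrix-tree theorem. -/
lemma det_killedLap (W : V → Option V → ℝ) :
    (killedLap W).det = ∑ π : V → Option V, if Acyc π then ∏ v, W v (π v) else 0 := by
  have h1 : killedLap W = fun v => ∑ o, W v o •
      (fun u => (if v = u then (1:ℝ) else 0) - (if o = some u then 1 else 0)) := by
    ext v u
    simp only [killedLap, Matrix.of_apply, Finset.sum_apply, Pi.smul_apply, smul_eq_mul, mul_sub,
      Finset.sum_sub_distrib, mul_ite, mul_one, mul_zero, Finset.sum_ite_eq', Finset.mem_univ,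
      if_true]
    split_ifs <;> simp
  have h2 := (Matrix.detRowAlternating (R := ℝ) (n := V)).toMultilinearMap.map_sum
    (fun v (o : Option V) => W v o •
      (fun u => (if v = u then (1:ℝ) else 0) - (if o = some u then 1 else 0)))
  have h3 : (killedLap W).det = ∑ r : V → Option V,
      (Matrix.detRowAlternating (R := ℝ) (n := V)) (fun v => W v (r v) •
      (fun u => (if v = u then (1:ℝ) else 0) - (if r v = some u then 1 else 0))) := by
    rw [h1]; exact h2
  rw [h3]
  refine Finset.sum_congr rfl fun π _ => ?_
  have h4 := (Matrix.detRowAlternating (R := ℝ) (n := V)).toMultilinearMap.map_smul_univ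
    (fun v => W v (π v))
    (fun v u => (if v = u then (1:ℝ) else 0) - (if π v = some u then 1 else 0))
  refine h4.trans ?_
  change _ • (stepMatrix π).det = _
  split_ifs with h
  · rw [det_stepMatrix_of_acyc h, smul_eq_mul, mul_one]
  · rw [det_stepMatrix_of_not_acyc h, smul_zero]

/-- Rooted forests, encoded by their parent maps. -/
abbrev Forest (V : Type) := {π : V → Option V // Acyc π}

instance : Fintype (Forest V) := Fintype.ofFinite _

/-- The edges of a rooted forest, with an extra vertex `none` joined to the roots. -/
def forestEdges (π : V → Option V) : Finset (Sym2 (Option V)) :=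
  univ.image fun v => s(some v, π v)

lemma forestEdges_injective {π : V → Option V} (h : Acyc π) :
    Function.Injective fun v => (s(some v, π v) : Sym2 (Option V)) := by
  obtain ⟨rk, hrk⟩ := h
  intro v u hvu
  simp only [Sym2.eq_iff] at hvu
  rcases hvu with ⟨h1, -⟩ | ⟨h1, h2⟩
  · exact Option.some_injective _ h1
  · have := hrk _ _ h2
    have := hrk _ _ h1.symm
    omega

lemma card_forestEdges {π : V → Option V} (h : Acyc π) :
    (forestEdges π).card = Fintype.card V := by
  rw [forestEdges, Finset.card_image_of_injective _ (forestEdges_injective h), Finset.card_univ]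

lemma prod_forestEdges {π : V → Option V} (h : Acyc π) (z : Sym2 (Option V) → ℝ) :
    ∏ e ∈ forestEdges π, z e = ∏ v, z s(some v, π v) := by
  rw [forestEdges, Finset.prod_image fun _ _ _ _ hh => forestEdges_injective h hh]

/-- The Laplacian of a symmetric weighting of the edges of `V ∪ {none}`. -/
def symLap (z : Sym2 (Option V) → ℝ) : Matrix V V ℝ := killedLap fun v o => z s(some v, o)

lemma det_symLap (z : Sym2 (Option V) → ℝ) :
    (symLap z).det = ∑ π : Forest V, ∏ e ∈ forestEdges π.1, z e := by
  classical
  rw [symLap, det_killedLap, ← Finset.sum_filter]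
  rw [Finset.sum_subtype (p := Acyc) _ (by simp)]
  exact Finset.sum_congr rfl fun π _ => (prod_forestEdges π.2 z).symm

lemma symLap_symm (z : Sym2 (Option V) → ℝ) : (symLap z).IsSymm := by
  ext v u
  simp only [symLap, killedLap, Matrix.transpose_apply, Matrix.of_apply]
  rw [Sym2.eq_swap]
  by_cases h : u = v
  · subst h; simp
  · simp [h, Ne.symm h]

lemma symLap_add (z z' : Sym2 (Option V) → ℝ) :
    symLap (fun e => z e + z' e) = symLap z + symLap z' := by
  ext v u
  simp only [symLap, killedLap, Matrix.of_apply, Matrix.add_apply, Finset.sum_add_distrib]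
  split_ifs <;> ring

/-- The incidence vector of an (oriented) edge. -/
def incVec (a b : Option V) : V → ℝ :=
  fun v => (if some v = a then 1 else 0) - (if some v = b then 1 else 0)

lemma symLap_single (a b : Option V) (s : ℝ) :
    symLap (fun e => if e = s(a, b) then s else 0) =
      s • Matrix.vecMulVec (incVec a b) (incVec a b) := by
  ext v u
  simp only [symLap, killedLap, Matrix.of_apply, Matrix.smul_apply, Matrix.vecMulVec_apply,
    smul_eq_mul, incVec, Sym2.eq_iff]
  by_cases hab : a = b
  · subst hab
    by_cases hva : some v = a
    · subst hva
      simp [eq_comm]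
    · simp [hva]
  · have hs : (∑ o, if some v = a ∧ o = b ∨ some v = b ∧ o = a then s else 0) =
        (if some v = a ∨ some v = b then s else 0) := by
      by_cases h1 : some v = a
      · have h2 : some v ≠ b := h1 ▸ hab
        simp [h1, hab]
      · by_cases h2 : some v = b
        · simp [h2, Ne.symm hab]
        · simp [h1, h2]
    rw [hs]
    by_cases huv : v = u
    · subst huv
      by_cases h1 : some v = a
      · have h2 : some v ≠ b := h1 ▸ hab
        simp [h1, hab]
      · by_cases h2 : some v = b
        · simp [h2, Ne.symm hab]
        · simp [h1, h2]
    · have huv' : some v ≠ some u := fun h => huv (Option.some_injective _ h)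
      by_cases h1 : some v = a
      · have h3 : some u ≠ a := h1 ▸ huv'.symm
        subst h1
        simp [huv, hab, Ne.symm huv]
      · by_cases h2 : some v = b
        · subst h2
          simp [huv, h1, Ne.symm huv]
          split_ifs <;> simp
        · simp [huv, h1, h2]

lemma det_add_two_rank_one {M : Matrix V V ℝ} (hM : M.IsSymm) (h0 : M.det ≠ 0) (x y : V → ℝ) :
    ∃ p q r : ℝ, ∀ s t : ℝ, (M + (s • Matrix.vecMulVec x x + t • Matrix.vecMulVec y y)).det =
      M.det * ((1 + s * p) * (1 + t * r) - s * t * q ^ 2) := by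
  have hu : IsUnit M.det := isUnit_iff_ne_zero.2 h0
  refine ⟨x ⬝ᵥ M⁻¹.mulVec x, x ⬝ᵥ M⁻¹.mulVec y, y ⬝ᵥ M⁻¹.mulVec y, fun s t => ?_⟩
  have hsym : y ⬝ᵥ M⁻¹.mulVec x = x ⬝ᵥ M⁻¹.mulVec y := by
    rw [dotProduct_comm, Matrix.dotProduct_mulVec, ← Matrix.mulVec_transpose,
      Matrix.transpose_nonsing_inv, hM.eq, dotProduct_comm]
  let U : Matrix V (Fin 2) ℝ := Matrix.of fun v i => if i = 0 then s * x v else t * y v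
  let Y : Matrix (Fin 2) V ℝ := Matrix.of fun i v => if i = 0 then x v else y v
  have hUY : s • Matrix.vecMulVec x x + t • Matrix.vecMulVec y y = U * Y := by
    ext v u
    simp [U, Y, Matrix.mul_apply, Fin.sum_univ_two, Matrix.vecMulVec_apply]
    ring
  have key : ∀ i j, (Y * M⁻¹ * U) i j =
      (if j = 0 then s else t) * ((if i = 0 then x else y) ⬝ᵥ M⁻¹.mulVec (if j = 0 then x else y)) := by
    intro i j
    rw [Matrix.mul_assoc, Matrix.mul_apply]
    simp only [Y, U, dotProduct, Matrix.mulVec, Matrix.mul_apply, Matrix.of_apply, Finset.mul_sum]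
    refine Finset.sum_congr rfl fun v _ => ?_
    refine Finset.sum_congr rfl fun u _ => ?_
    split_ifs <;> ring
  rw [hUY, Matrix.det_add_mul _ _ hu, Matrix.det_fin_two]
  simp only [Matrix.add_apply, key, Matrix.one_apply]
  simp [hsym]
  left; ring

/-- The weight of a rooted forest. -/
def forestWeight (z : Sym2 (Option V) → ℝ) (π : Forest V) : ℝ := ∏ e ∈ forestEdges π.1, z e

lemma prod_scale_two {E : Type*} [DecidableEq E] (S : Finset E) (z : E → ℝ) {e f : E}
    (hef : e ≠ f) (s t : ℝ) :
    ∏ g ∈ S, (if g = e then s * z g else if g = f then t * z g else z g) =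
      (if e ∈ S then s else 1) * (if f ∈ S then t else 1) * ∏ g ∈ S, z g := by
  have : ∀ g, (if g = e then s * z g else if g = f then t * z g else z g) =
      (if g = e then s else 1) * (if g = f then t else 1) * z g := by
    intro g
    by_cases h1 : g = e
    · subst h1; simp [hef]
    · by_cases h2 : g = f
      · subst h2; simp [h1]
      · simp [h1, h2]
  simp only [this, Finset.prod_mul_distrib, Finset.prod_ite_eq']

lemma det_symLap_scale (z : Sym2 (Option V) → ℝ) {e f : Sym2 (Option V)} (hef : e ≠ f)
    (s t : ℝ) :
    (symLap fun g => if g = e then s * z g else if g = f then t * z g else z g).det =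
      condSum (fun π : Forest V => forestEdges π.1) (forestWeight z) ∅ {f, e} +
      s * condSum (fun π : Forest V => forestEdges π.1) (forestWeight z) {e} {f} +
      t * condSum (fun π : Forest V => forestEdges π.1) (forestWeight z) {f} {e} +
      s * t * condSum (fun π : Forest V => forestEdges π.1) (forestWeight z) {f, e} ∅ := by
  rw [det_symLap]
  unfold condSum
  rw [Finset.mul_sum, Finset.mul_sum, Finset.mul_sum, ← Finset.sum_add_distrib,
    ← Finset.sum_add_distrib, ← Finset.sum_add_distrib]
  refine Finset.sum_congr rfl fun π _ => ?_
  rw [prod_scale_two _ z hef, forestWeight]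
  by_cases he : e ∈ forestEdges π.1 <;> by_cases hf : f ∈ forestEdges π.1 <;>
    simp [he, hf, Finset.insert_subset_iff]

lemma forest_rayleigh {z : Sym2 (Option V) → ℝ} (hz : ∀ e, 0 ≤ z e) {e f : Sym2 (Option V)}
    (hef : e ≠ f) :
    condSum (fun π : Forest V => forestEdges π.1) (forestWeight z) {f, e} ∅ *
        condSum (fun π : Forest V => forestEdges π.1) (forestWeight z) ∅ {f, e} ≤
      condSum (fun π : Forest V => forestEdges π.1) (forestWeight z) {e} {f} *
        condSum (fun π : Forest V => forestEdges π.1) (forestWeight z) {f} {e} := by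
  have hw : ∀ π : Forest V, 0 ≤ forestWeight z π := fun π => Finset.prod_nonneg fun _ _ => hz _
  have H := det_symLap_scale z hef
  have b0 := condSum_nonneg hw (S := fun π : Forest V => forestEdges π.1) {e} {f}
  have c0 := condSum_nonneg hw (S := fun π : Forest V => forestEdges π.1) {f} {e}
  revert H b0 c0
  generalize condSum (fun π : Forest V => forestEdges π.1) (forestWeight z) ∅ {f, e} = α
  generalize condSum (fun π : Forest V => forestEdges π.1) (forestWeight z) {e} {f} = b
  generalize condSum (fun π : Forest V => forestEdges π.1) (forestWeight z) {f} {e} = c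
  generalize condSum (fun π : Forest V => forestEdges π.1) (forestWeight z) {f, e} ∅ = δ
  intro H b0 c0
  by_cases hα : α = 0
  · subst hα; simpa using mul_nonneg b0 c0
  set M := symLap fun g => if g = e then 0 * z g else if g = f then 0 * z g else z g with hM
  have hdet : M.det = α := by rw [hM, H]; ring
  induction e using Sym2.inductionOn with | _ a a' =>
  induction f using Sym2.inductionOn with | _ b₁ b₂ =>
  obtain ⟨p, q, r, hpqr⟩ := det_add_two_rank_one (symLap_symm _ : M.IsSymm) (hdet ▸ hα)
    (incVec a a') (incVec b₁ b₂)
  have key : ∀ s t : ℝ, (symLap fun g => if g = s(a, a') then s * z g else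
      if g = s(b₁, b₂) then t * z g else z g) =
      M + ((s * z s(a, a')) • Matrix.vecMulVec (incVec a a') (incVec a a') +
        (t * z s(b₁, b₂)) • Matrix.vecMulVec (incVec b₁ b₂) (incVec b₁ b₂)) := by
    intro s t
    rw [← symLap_single, ← symLap_single, ← symLap_add, hM, ← symLap_add]
    congr 1
    funext g
    by_cases h1 : g = s(a, a')
    · subst h1; simp [hef]
    · by_cases h2 : g = s(b₁, b₂)
      · subst h2; simp [h1]
      · simp [h1, h2]
  have D : ∀ s t : ℝ, α + s * b + t * c + s * t * δ =
      α * ((1 + s * z s(a, a') * p) * (1 + t * z s(b₁, b₂) * r)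
        - s * z s(a, a') * (t * z s(b₁, b₂)) * q ^ 2) := by
    intro s t
    rw [← H, key, hpqr, hdet]
  have h10 := D 1 0
  have h01 := D 0 1
  have h11 := D 1 1
  have hb : b = α * (z s(a, a') * p) := by linarith
  have hc : c = α * (z s(b₁, b₂) * r) := by linarith
  have hδ : δ = α * (z s(a, a') * z s(b₁, b₂)) * (p * r - q ^ 2) := by
    rw [hb, hc] at h11; linarith
  have h1 : 0 ≤ z s(a, a') * z s(b₁, b₂) * (α * q) ^ 2 :=
    mul_nonneg (mul_nonneg (hz _) (hz _)) (sq_nonneg _)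
  rw [hb, hc, hδ]
  nlinarith

lemma forest_negCorr {z : Sym2 (Option V) → ℝ} (hz : ∀ e, 0 ≤ z e) :
    NegCorr (fun π : Forest V => forestEdges π.1) (forestWeight z) := by
  intro I O e f hef
  have hw : ∀ π : Forest V, 0 ≤ forestWeight z π := fun π => Finset.prod_nonneg fun _ _ => hz _
  have nn := fun I O => condSum_nonneg hw (S := fun π : Forest V => forestEdges π.1) I O
  by_cases heI : e ∈ I
  · rw [condSum_eq_zero_of_mem (e := e) (I := I) (O := insert f (insert e O)) heI (by simp),
      mul_zero]
    exact mul_nonneg (nn _ _) (nn _ _)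
  by_cases hfI : f ∈ I
  · rw [condSum_eq_zero_of_mem (e := f) (I := I) (O := insert f (insert e O)) hfI (by simp),
      mul_zero]
    exact mul_nonneg (nn _ _) (nn _ _)
  by_cases heO : e ∈ O
  · rw [condSum_eq_zero_of_mem (e := e) (I := insert f (insert e I)) (O := O) (by simp) heO,
      zero_mul]
    exact mul_nonneg (nn _ _) (nn _ _)
  by_cases hfO : f ∈ O
  · rw [condSum_eq_zero_of_mem (e := f) (I := insert f (insert e I)) (O := O) (by simp) hfO,
      zero_mul]
    exact mul_nonneg (nn _ _) (nn _ _)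
  let ws : ℝ → Forest V → ℝ := fun s π =>
    if Disjoint O (forestEdges π.1) then s ^ (I \ forestEdges π.1).card * forestWeight z π else 0
  have hws : ∀ s : ℝ, 0 < s → ∀ π, ws s π = s ^ I.card *
      forestWeight (fun g => if g ∈ O then 0 else if g ∈ I then s⁻¹ * z g else z g) π := by
    intro s hs π
    simp only [ws, forestWeight]
    split_ifs with h
    · have : ∏ e ∈ forestEdges π.1, (if e ∈ O then 0 else if e ∈ I then s⁻¹ * z e else z e) =
          s⁻¹ ^ (forestEdges π.1 ∩ I).card * ∏ e ∈ forestEdges π.1, z e := by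
        rw [Finset.card_eq_sum_ones, ← Finset.prod_pow_eq_pow_sum, ← Finset.prod_ite_mem,
          ← Finset.prod_mul_distrib]
        refine Finset.prod_congr rfl fun g hg => ?_
        rw [if_neg fun hO => Finset.disjoint_left.1 h hO hg]
        split_ifs <;> simp
      rw [this, ← mul_assoc]
      congr 1
      have hc : I.card = (I \ forestEdges π.1).card + (forestEdges π.1 ∩ I).card := by
        rw [Finset.inter_comm]; exact (Finset.card_sdiff_add_card_inter _ _).symm
      rw [hc, pow_add, mul_assoc, ← mul_pow, mul_inv_cancel₀ hs.ne', one_pow, mul_one]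
    · obtain ⟨g, hgO, hgS⟩ := Finset.not_disjoint_iff.1 h
      rw [Finset.prod_eq_zero hgS (by simp [hgO]), mul_zero]
  have hray : ∀ s : ℝ, 0 < s →
      condSum (fun π : Forest V => forestEdges π.1) (ws s) {f, e} ∅ *
        condSum (fun π : Forest V => forestEdges π.1) (ws s) ∅ {f, e} ≤
      condSum (fun π : Forest V => forestEdges π.1) (ws s) {e} {f} *
        condSum (fun π : Forest V => forestEdges π.1) (ws s) {f} {e} := by
    intro s hs
    have hz' : ∀ g, 0 ≤ (if g ∈ O then 0 else if g ∈ I then s⁻¹ * z g else z g) := by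
      intro g
      split_ifs
      exacts [le_rfl, mul_nonneg (inv_nonneg.2 hs.le) (hz g), hz g]
    have h1 := forest_rayleigh hz' hef
    have h2 : ∀ A B, condSum (fun π : Forest V => forestEdges π.1) (ws s) A B = s ^ I.card *
        condSum (fun π : Forest V => forestEdges π.1) (forestWeight
          (fun g => if g ∈ O then 0 else if g ∈ I then s⁻¹ * z g else z g)) A B := by
      intro A B
      unfold condSum
      rw [Finset.mul_sum]
      refine Finset.sum_congr rfl fun π _ => ?_
      split_ifs
      · exact hws s hs π
      · simp
    simp only [h2]
    have h3 : 0 ≤ s ^ I.card * s ^ I.card := by positivity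
    nlinarith [mul_le_mul_of_nonneg_left h1 h3]
  have hcont : ∀ A B, Continuous fun s =>
      condSum (fun π : Forest V => forestEdges π.1) (ws s) A B := by
    intro A B
    refine continuous_finsetSum _ fun π _ => ?_
    simp only [ws]
    split_ifs <;> fun_prop
  have h0 : ∀ A B, condSum (fun π : Forest V => forestEdges π.1) (ws 0) A B =
      condSum (fun π : Forest V => forestEdges π.1) (forestWeight z) (A ∪ I) (B ∪ O) := by
    intro A B
    refine Finset.sum_congr rfl fun π _ => ?_
    simp only [ws, Finset.union_subset_iff, Finset.disjoint_union_left]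
    by_cases hI : I ⊆ forestEdges π.1
    · rw [Finset.sdiff_eq_empty_iff_subset.2 hI]
      simp only [hI, and_true, Finset.card_empty, pow_zero, one_mul]
      rw [← ite_and]
      congr 1
      simp only [eq_iff_iff]; tauto
    · have : (I \ forestEdges π.1).card ≠ 0 := by
        rwa [Ne, Finset.card_eq_zero, Finset.sdiff_eq_empty_iff_subset]
      simp [this, hI]
  have hlim : 0 ≤ condSum (fun π : Forest V => forestEdges π.1) (ws 0) {e} {f} *
        condSum (fun π : Forest V => forestEdges π.1) (ws 0) {f} {e} -
      condSum (fun π : Forest V => forestEdges π.1) (ws 0) {f, e} ∅ *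
        condSum (fun π : Forest V => forestEdges π.1) (ws 0) ∅ {f, e} := by
    refine ge_of_tendsto (x := nhdsWithin (0:ℝ) (Set.Ioi 0))
      ((((hcont _ _).mul (hcont _ _)).sub
        ((hcont _ _).mul (hcont _ _))).continuousAt.tendsto.mono_left nhdsWithin_le_nhds)
      (eventually_nhdsWithin_of_forall fun s hs => sub_nonneg.2 (hray s hs))
  simp only [h0] at hlim
  simpa [Finset.insert_union, Finset.singleton_union, sub_nonneg] using hlim

/-- Extend edge weights `a` on `V` to `V ∪ {none}` by giving weight `k v` to `{v, none}`. -/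
def extW (a : Sym2 V → ℝ) (k : V → ℝ) : Sym2 (Option V) → ℝ :=
  Sym2.lift ⟨fun o o' => match o, o' with
    | none, none => 0
    | some v, none => k v
    | none, some v => k v
    | some v, some u => a s(v, u), by
      rintro (_ | v) (_ | u) <;> simp [Sym2.eq_swap]⟩

@[simp] lemma extW_none (a : Sym2 V → ℝ) (k : V → ℝ) (v : V) :
    extW a k s(some v, none) = k v := rfl

@[simp] lemma extW_some (a : Sym2 V → ℝ) (k : V → ℝ) (v u : V) :
    extW a k s(some v, some u) = a s(v, u) := rfl

open scoped Classical in
/-- The edge weights of `G` with conductances `c`. -/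
def edgeW (G : SimpleGraph V) (c : Sym2 V → ℝ) (e : Sym2 V) : ℝ := if e ∈ G.edgeSet then c e else 0

/-- The edges of a set that do not touch `none`. -/
def inner (S : Finset (Sym2 (Option V))) : Finset (Sym2 V) :=
  univ.filter fun e => e.map some ∈ S

/-- The edges joining a vertex other than `ρ` to `none`. -/
def offRoot (ρ : V) : Finset (Sym2 (Option V)) :=
  (univ.erase ρ).image fun v => s(some v, none)

lemma mk_none_mem_forestEdges {π : V → Option V} {v : V} :
    s(some v, none) ∈ forestEdges π ↔ π v = none := by
  simp only [forestEdges, mem_image, mem_univ, true_and, Sym2.eq_iff]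
  constructor
  · rintro ⟨u, ⟨h1, h2⟩ | ⟨h1, h2⟩⟩
    · rwa [← Option.some_injective _ h1]
    · cases h1
  · intro h; exact ⟨v, Or.inl ⟨rfl, h⟩⟩

lemma mk_some_mem_forestEdges {π : V → Option V} {v u : V} :
    s(some v, some u) ∈ forestEdges π ↔ π v = some u ∨ π u = some v := by
  simp only [forestEdges, mem_image, mem_univ, true_and, Sym2.eq_iff]
  constructor
  · rintro ⟨x, ⟨h1, h2⟩ | ⟨h1, h2⟩⟩
    · left; rwa [← Option.some_injective _ h1]
    · right; rwa [← Option.some_injective _ h1]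
  · rintro (h | h)
    · exact ⟨v, Or.inl ⟨rfl, h⟩⟩
    · exact ⟨u, Or.inr ⟨rfl, h⟩⟩

lemma mk_mem_inner {π : V → Option V} {v u : V} :
    s(v, u) ∈ inner (forestEdges π) ↔ π v = some u ∨ π u = some v := by
  simp [inner, mk_some_mem_forestEdges]

lemma disjoint_offRoot {π : V → Option V} {ρ : V} :
    Disjoint (offRoot ρ) (forestEdges π) ↔ ∀ v, π v = none → v = ρ := by
  rw [Finset.disjoint_left]
  constructor
  · intro h v hv
    by_contra hne
    exact h (mem_image.2 ⟨v, by simp [hne], rfl⟩) (mk_none_mem_forestEdges.2 hv)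
  · rintro h e he he'
    obtain ⟨v, hv, rfl⟩ := mem_image.1 he
    exact (Finset.mem_erase.1 hv).1 (h v (mk_none_mem_forestEdges.1 he'))

/-- The set of roots. -/
def roots (π : V → Option V) : Finset V := univ.filter fun v => π v = none

lemma inner_eq_image {π : V → Option V} :
    inner (forestEdges π) = (univ \ roots π).image fun v => s(v, (π v).getD v) := by
  ext e
  induction e using Sym2.inductionOn with | _ v u =>
  rw [mk_mem_inner]
  simp only [roots, mem_image, Finset.mem_sdiff, mem_univ, mem_filter, true_and, Sym2.eq_iff]
  constructor
  · rintro (h | h)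
    · exact ⟨v, by simp [h], by simp [h]⟩
    · exact ⟨u, by simp [h], by simp [h]⟩
  · rintro ⟨x, hx, h⟩
    obtain ⟨y, hy⟩ := Option.ne_none_iff_exists'.1 hx
    rw [hy] at h
    rcases h with ⟨rfl, h⟩ | ⟨rfl, h⟩
    · left; rw [hy, ← h]; rfl
    · right; rw [hy, ← h]; rfl

lemma getD_injOn {π : V → Option V} (h : Acyc π) :
    Set.InjOn (fun v => s(v, (π v).getD v)) (univ \ roots π : Finset V) := by
  intro v hv u hu hvu
  simp only [roots, coe_sdiff, coe_univ, Set.mem_sdiff, Set.mem_univ, mem_coe, mem_filter, mem_univ,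
    true_and] at hv hu
  obtain ⟨v', hv'⟩ := Option.ne_none_iff_exists'.1 hv
  obtain ⟨u', hu'⟩ := Option.ne_none_iff_exists'.1 hu
  simp only [hv', hu', Option.getD_some, Sym2.eq_iff] at hvu
  obtain ⟨rk, hrk⟩ := h
  rcases hvu with ⟨h1, -⟩ | ⟨rfl, rfl⟩
  · exact h1
  · have := hrk _ _ hv'
    have := hrk _ _ hu'
    omega

lemma card_inner_add_card_roots {π : V → Option V} (h : Acyc π) :
    (inner (forestEdges π)).card + (roots π).card = Fintype.card V := by
  rw [inner_eq_image, Finset.card_image_of_injOn (getD_injOn h),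
    Finset.card_sdiff_add_card_eq_card (Finset.subset_univ _), Finset.card_univ]

lemma roots_nonempty [Nonempty V] {π : V → Option V} (h : Acyc π) : (roots π).Nonempty := by
  obtain ⟨rk, hrk⟩ := h
  obtain ⟨v, hv⟩ := Finite.exists_min rk
  refine ⟨v, by
    simp only [roots, mem_filter, mem_univ, true_and]
    rcases hu : π v with _ | u
    · rfl
    · have := hrk _ _ hu
      have := hv u
      omega⟩

lemma forestWeight_extW (a : Sym2 V → ℝ) (k : V → ℝ) (π : Forest V) :
    forestWeight (extW a k) π =
      (∏ v ∈ roots π.1, k v) * ∏ e ∈ inner (forestEdges π.1), a e := by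
  rw [forestWeight, prod_forestEdges π.2, inner_eq_image, Finset.prod_image (getD_injOn π.2),
    ← Finset.prod_sdiff (Finset.subset_univ (roots π.1)), mul_comm]
  congr 1
  · refine Finset.prod_congr rfl fun v hv => ?_
    simp only [roots, mem_filter, mem_univ, true_and] at hv
    simp [hv]
  · refine Finset.prod_congr rfl fun v hv => ?_
    simp only [roots, Finset.mem_sdiff, mem_filter, mem_univ, true_and] at hv
    obtain ⟨v', hv'⟩ := Option.ne_none_iff_exists'.1 hv
    simp [hv']

/-- Parent maps of the spanning trees of `G` rooted at `ρ`. -/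
def IsRootedTree (G : SimpleGraph V) (ρ : V) (π : V → Option V) : Prop :=
  (∀ v, π v = none → v = ρ) ∧ ∀ v u, π v = some u → G.Adj v u

lemma roots_of_isRootedTree {G : SimpleGraph V} {ρ : V} {π : V → Option V} (h : Acyc π)
    (hπ : IsRootedTree G ρ π) : roots π = {ρ} := by
  have : Nonempty V := ⟨ρ⟩
  refine Finset.eq_singleton_iff_nonempty_unique_mem.2 ⟨roots_nonempty h, fun v hv => hπ.1 v ?_⟩
  simpa [roots] using hv

lemma inner_mem_spanningTrees {G : SimpleGraph V} {ρ : V} {π : V → Option V} (h : Acyc π)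
    (hπ : IsRootedTree G ρ π) : inner (forestEdges π) ∈ spanningTrees G := by
  classical
  have hsub : (↑(inner (forestEdges π)) : Set (Sym2 V)) ⊆ G.edgeSet := by
    intro e he
    induction e using Sym2.inductionOn with | _ v u =>
    rw [mem_coe, mk_mem_inner] at he
    rcases he with he | he
    · exact hπ.2 _ _ he
    · exact (hπ.2 _ _ he).symm
  have hR := roots_of_isRootedTree h hπ
  have hcard := card_inner_add_card_roots h
  rw [hR, Finset.card_singleton] at hcard
  refine Finset.mem_filter.2 ⟨mem_univ _, hsub, ?_⟩
  rw [SimpleGraph.isTree_iff_connected_and_card]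
  constructor
  · obtain ⟨rk, hrk⟩ := h
    have hreach : ∀ m v, rk v = m →
        (SimpleGraph.fromEdgeSet (↑(inner (forestEdges π)) : Set (Sym2 V))).Reachable v ρ := by
      intro m
      induction m using Nat.strong_induction_on with | _ m ih =>
      intro v hv
      rcases hu : π v with _ | u
      · rw [hπ.1 v hu]
      · have h1 := hrk _ _ hu
        refine SimpleGraph.Reachable.trans (SimpleGraph.Adj.reachable ?_) (ih _ (hv ▸ h1) u rfl)
        rw [SimpleGraph.fromEdgeSet_adj]
        exact ⟨by rw [mem_coe, mk_mem_inner]; exact Or.inl hu, (hπ.2 _ _ hu).ne⟩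
    have : Nonempty V := ⟨ρ⟩
    exact ⟨fun v u => (hreach _ v rfl).trans (hreach _ u rfl).symm⟩
  · have : (SimpleGraph.fromEdgeSet (↑(inner (forestEdges π)) : Set (Sym2 V))).edgeSet =
        ↑(inner (forestEdges π)) := by
      rw [SimpleGraph.edgeSet_fromEdgeSet, sdiff_eq_left]
      exact Set.disjoint_left.2 fun e he hd => G.not_isDiag_of_mem_edgeSet (hsub he) hd
    rw [this, Nat.card_coe_set_eq, Set.ncard_coe_finset, Nat.card_eq_fintype_card]
    exact hcard

lemma isRootedTree_injective {G : SimpleGraph V} {ρ : V} {π π' : V → Option V} (h : Acyc π')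
    (hπ : IsRootedTree G ρ π) (hπ' : IsRootedTree G ρ π') (hA : Acyc π)
    (heq : inner (forestEdges π) = inner (forestEdges π')) : π = π' := by
  by_contra hne
  have hR := roots_of_isRootedTree hA hπ
  have hR' := roots_of_isRootedTree h hπ'
  obtain ⟨rk, hrk⟩ := h
  obtain ⟨v₀, hv₀⟩ := Function.ne_iff.1 hne
  classical
  obtain ⟨v, hv, hmin⟩ := Finset.exists_min_image (univ.filter fun v => π v ≠ π' v) rk
    ⟨v₀, by simp [hv₀]⟩
  simp only [mem_filter, mem_univ, true_and] at hv hmin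
  rcases hu : π' v with _ | u
  · have h1 : v ∈ roots π' := by simp [roots, hu]
    rw [hR', ← hR] at h1
    have h2 : π v = none := by simpa [roots] using h1
    exact hv (h2.trans hu.symm)
  · have h1 : s(v, u) ∈ inner (forestEdges π) := by
      rw [heq, mk_mem_inner]; exact Or.inl hu
    rw [mk_mem_inner] at h1
    rcases h1 with h1 | h1
    · exact hv (h1.trans hu.symm)
    · have h2 := hrk _ _ hu
      have h3 : π u = π' u := by
        by_contra h4
        have := hmin u h4
        omega
      have := hrk _ _ (h3.symm.trans h1)
      omega

lemma exists_isRootedTree {G : SimpleGraph V} (ρ : V) {T : Finset (Sym2 V)}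
    (hT : T ∈ spanningTrees G) :
    ∃ π : V → Option V, Acyc π ∧ IsRootedTree G ρ π ∧ inner (forestEdges π) = T := by
  classical
  obtain ⟨-, hsub, htree⟩ := Finset.mem_filter.1 hT
  set Γ := SimpleGraph.fromEdgeSet (↑T : Set (Sym2 V)) with hΓ
  have hex : ∀ v, v ≠ ρ → ∃ u, Γ.Adj v u ∧ Γ.dist u ρ < Γ.dist v ρ := by
    intro v hv
    obtain ⟨p, hp⟩ := (htree.1.preconnected v ρ).exists_walk_length_eq_dist
    cases p with
    | nil => exact absurd rfl hv
    | cons hadj q =>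
      refine ⟨_, hadj, ?_⟩
      rw [← hp, SimpleGraph.Walk.length_cons]
      exact Nat.lt_succ_of_le (SimpleGraph.dist_le q)
  choose! p hp using hex
  have hA : Acyc (fun v => if v = ρ then none else some (p v)) := by
    refine ⟨fun v => Γ.dist v ρ, fun v u hvu => ?_⟩
    by_cases hv : v = ρ
    · simp [hv] at hvu
    · simp only [hv, if_false, Option.some.injEq] at hvu
      subst hvu; exact (hp v hv).2
  have hmem : ∀ v, v ≠ ρ → s(v, p v) ∈ T := fun v hv => by
    have := (hp v hv).1
    rw [hΓ, SimpleGraph.fromEdgeSet_adj] at this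
    exact this.1
  have hRT : IsRootedTree G ρ (fun v => if v = ρ then none else some (p v)) := by
    constructor
    · intro v hv; by_contra hne; simp [hne] at hv
    · intro v u hvu
      by_cases hv : v = ρ
      · simp [hv] at hvu
      · simp only [hv, if_false, Option.some.injEq] at hvu
        subst hvu
        exact hsub (hmem v hv)
  refine ⟨_, hA, hRT, ?_⟩
  have hR := roots_of_isRootedTree hA hRT
  have hcard := card_inner_add_card_roots hA
  rw [hR, Finset.card_singleton] at hcard
  refine Finset.eq_of_subset_of_card_le ?_ ?_
  · rw [inner_eq_image]
    intro e he
    obtain ⟨v, hv, rfl⟩ := Finset.mem_image.1 he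
    rw [hR] at hv
    have hv : v ≠ ρ := by simpa using hv
    simpa [hv] using hmem v hv
  · have h2 := (SimpleGraph.isTree_iff_connected_and_card.1 htree).2
    have : Γ.edgeSet = ↑T := by
      rw [hΓ, SimpleGraph.edgeSet_fromEdgeSet, sdiff_eq_left]
      exact Set.disjoint_left.2 fun e he hd => G.not_isDiag_of_mem_edgeSet (hsub he) hd
    rw [this, Nat.card_coe_set_eq, Set.ncard_coe_finset, Nat.card_eq_fintype_card] at h2
    omega

lemma sum_rooted_eq (G : SimpleGraph V) (c : Sym2 V → ℝ) (k : V → ℝ) (ρ : V)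
    (g : Finset (Sym2 V) → ℝ) :
    condSum (fun π : Forest V => forestEdges π.1)
      (fun π => forestWeight (extW (edgeW G c) k) π * g (inner (forestEdges π.1))) ∅ (offRoot ρ) =
    k ρ * ∑ T ∈ spanningTrees G, treeWeight c T * g T := by
  classical
  unfold condSum
  rw [← Finset.sum_filter, Finset.mul_sum]
  have hsub : (univ.filter fun π : Forest V => IsRootedTree G ρ π.1) ⊆
      univ.filter fun π : Forest V => ∅ ⊆ forestEdges π.1 ∧
        Disjoint (offRoot ρ) (forestEdges π.1) := by
    intro π hπ
    simp only [mem_filter, mem_univ, true_and, empty_subset] at hπ ⊢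
    exact disjoint_offRoot.2 hπ.1
  rw [← Finset.sum_subset hsub]
  · refine Finset.sum_bij (fun π _ => inner (forestEdges π.1)) ?_ ?_ ?_ ?_
    · intro π hπ
      exact inner_mem_spanningTrees π.2 (Finset.mem_filter.1 hπ).2
    · intro π hπ π' hπ' heq
      exact Subtype.ext (isRootedTree_injective π'.2 (Finset.mem_filter.1 hπ).2
        (Finset.mem_filter.1 hπ').2 π.2 heq)
    · intro T hT
      obtain ⟨π, hA, hRT, heq⟩ := exists_isRootedTree ρ hT
      exact ⟨⟨π, hA⟩, Finset.mem_filter.2 ⟨mem_univ _, hRT⟩, heq⟩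
    · intro π hπ
      have hRT := (Finset.mem_filter.1 hπ).2
      rw [forestWeight_extW, roots_of_isRootedTree π.2 hRT, Finset.prod_singleton, mul_assoc]
      congr 2
      refine Finset.prod_congr rfl fun e he => if_pos ?_
      exact (Finset.mem_filter.1 (inner_mem_spanningTrees π.2 hRT)).2.1 he
  · intro π hπ hπ'
    simp only [mem_filter, mem_univ, true_and, empty_subset, disjoint_offRoot] at hπ hπ'
    simp only [IsRootedTree, not_and, not_forall] at hπ'
    obtain ⟨v, u, hvu, hadj⟩ := hπ' hπ
    rw [forestWeight_extW, Finset.prod_eq_zero (i := s(v, u)) (mk_mem_inner.2 (Or.inl hvu)),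
      mul_zero, zero_mul]
    exact if_neg hadj

lemma partZ_pos {G : SimpleGraph V} (hG : G.Connected) {c : Sym2 V → ℝ} (hc : ∀ e, 0 < c e) :
    0 < partZ G c := by
  classical
  refine Finset.sum_pos (fun T _ => Finset.prod_pos fun e _ => hc e) ?_
  obtain ⟨T, hle, hT⟩ := hG.exists_isTree_le
  refine ⟨T.edgeFinset, Finset.mem_filter.2 ⟨mem_univ _, ?_, ?_⟩⟩
  · simpa using hle
  · simpa using hT

/-- Mean of a function of the weighted spanning tree. -/
def treeMean (G : SimpleGraph V) (c : Sym2 V → ℝ) (f : Finset (Sym2 V) → ℝ) : ℝ :=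
  (∑ T ∈ spanningTrees G, treeWeight c T * f T) / partZ G c

/-- Mean of a function of the killed spanning forest. -/
def forestMean (z : Sym2 (Option V) → ℝ) (h : (V → Option V) → ℝ) : ℝ :=
  (∑ π : Forest V, forestWeight z π * h π.1) / ∑ π : Forest V, forestWeight z π

lemma card_of_mem_spanningTrees {G : SimpleGraph V} (ρ : V) {T : Finset (Sym2 V)}
    (hT : T ∈ spanningTrees G) : T.card + 1 = Fintype.card V := by
  obtain ⟨π, hA, hRT, heq⟩ := exists_isRootedTree ρ hT
  have := card_inner_add_card_roots hA
  rwa [heq, roots_of_isRootedTree hA hRT, Finset.card_singleton] at this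

lemma extW_nonneg {a : Sym2 V → ℝ} {k : V → ℝ} (ha : ∀ e, 0 ≤ a e) (hk : ∀ v, 0 ≤ k v)
    (e : Sym2 (Option V)) : 0 ≤ extW a k e := by
  induction e using Sym2.inductionOn with | _ o o' =>
  rcases o with _ | v <;> rcases o' with _ | u
  · exact le_rfl
  · exact hk u
  · exact hk v
  · exact ha _

lemma edgeW_nonneg (G : SimpleGraph V) {c : Sym2 V → ℝ} (hc : ∀ e, 0 < c e) (e : Sym2 V) :
    0 ≤ edgeW G c e := by
  unfold edgeW; split_ifs
  exacts [(hc e).le, le_rfl]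

lemma forestWeight_nonneg {z : Sym2 (Option V) → ℝ} (hz : ∀ e, 0 ≤ z e) (π : Forest V) :
    0 ≤ forestWeight z π := Finset.prod_nonneg fun _ _ => hz _

lemma acyc_none : Acyc (fun _ : V => none) := ⟨fun _ => 0, fun _ _ h => by simp at h⟩

lemma sum_forestWeight_pos {a : Sym2 V → ℝ} {k : V → ℝ} (ha : ∀ e, 0 ≤ a e)
    (hk : ∀ v, 0 < k v) : 0 < ∑ π : Forest V, forestWeight (extW a k) π := by
  refine Finset.sum_pos' (fun π _ => forestWeight_nonneg (extW_nonneg ha fun v => (hk v).le) π)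
    ⟨⟨fun _ => none, acyc_none⟩, mem_univ _, ?_⟩
  rw [forestWeight, prod_forestEdges acyc_none]
  exact Finset.prod_pos fun v _ => by simpa using hk v

lemma monotone_add_card {E : Type*} [DecidableEq E] {f : Finset E → ℝ} {L : ℝ}
    (hf : ∀ e S, f S ≤ f (insert e S) + L) : Monotone fun S : Finset E => f S + L * S.card := by
  refine Finset.monotone_iff_forall_le_insert.2 fun S e he => ?_
  rw [Finset.card_insert_of_notMem he]; push_cast; linarith [hf e S]

lemma inner_insert_map (e : Sym2 V) (S : Finset (Sym2 (Option V))) :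
    inner (insert (e.map some) S) = insert e (inner S) := by
  ext e'
  simp only [inner, mem_filter, mem_univ, true_and, mem_insert]
  rw [(Sym2.map.injective (Option.some_injective V)).eq_iff]

lemma inner_mono : Monotone (inner : Finset (Sym2 (Option V)) → Finset (Sym2 V)) :=
  fun _ _ h _ he => by
    simp only [inner, mem_filter, mem_univ, true_and] at he ⊢
    exact h he

lemma inner_insert_offRoot {ρ : V} {e : Sym2 (Option V)} (he : e ∈ offRoot ρ)
    (S : Finset (Sym2 (Option V))) : inner (insert e S) = inner S := by
  obtain ⟨v, -, rfl⟩ := Finset.mem_image.1 he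
  ext e'
  induction e' using Sym2.inductionOn with | _ x y =>
  simp [inner]

/-- Conditioning a killed forest to be a tree changes means of Lipschitz functions by at most
the mean number of roots (up to the Lipschitz constant). -/
lemma forestMean_le_treeMean {G : SimpleGraph V} (hG : G.Connected) {c : Sym2 V → ℝ}
    (hc : ∀ e, 0 < c e) {k : V → ℝ} (hk : ∀ v, 0 < k v) {f : Finset (Sym2 V) → ℝ} {L : ℝ}
    (hL : 0 ≤ L) (hf : ∀ e S, f S ≤ f (insert e S) + L) :
    forestMean (extW (edgeW G c) k) (fun π => f (inner (forestEdges π))) ≤ treeMean G c f +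
      L * forestMean (extW (edgeW G c) k) (fun π => ((roots π).card : ℝ)) := by
  obtain ⟨ρ⟩ := hG.nonempty
  set z := extW (edgeW G c) k with hz
  have hz0 : ∀ e, 0 ≤ z e := extW_nonneg (edgeW_nonneg G hc) fun v => (hk v).le
  have hZ := sum_forestWeight_pos (edgeW_nonneg G hc) hk
  rw [← hz] at hZ
  have hT := partZ_pos hG hc
  have hmono : Monotone fun S : Finset (Sym2 (Option V)) =>
      f (inner S) + L * (inner S).card := fun S T h => monotone_add_card hf (inner_mono h)
  have h1 := sum_rooted_eq G c k ρ (fun _ => 1)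
  simp only [mul_one] at h1
  change condSum _ (forestWeight z) ∅ (offRoot ρ) = k ρ * partZ G c at h1
  have h2 := sum_rooted_eq G c k ρ (fun S => f S + L * S.card)
  have key := condSum_delete_le (S := fun π : Forest V => forestEdges π.1) (w := forestWeight z)
    (forestWeight_nonneg hz0) (fun π => card_forestEdges π.2) (forest_negCorr hz0) hmono
    (offRoot ρ) (fun e he A => by simp only [inner_insert_offRoot he])
    (by rw [h1]; exact mul_pos (hk ρ) hT)
  rw [h1, ← hz] at *
  rw [h2] at key
  have hall : ∀ w : Forest V → ℝ,
      condSum (fun π : Forest V => forestEdges π.1) w ∅ ∅ = ∑ π, w π := by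
    intro w; simp [condSum]
  rw [hall, hall] at key
  have hT2 : ∑ T ∈ spanningTrees G, treeWeight c T * (f T + L * T.card) =
      (∑ T ∈ spanningTrees G, treeWeight c T * f T) +
        L * ((Fintype.card V : ℝ) - 1) * partZ G c := by
    rw [partZ, Finset.mul_sum, ← Finset.sum_add_distrib]
    refine Finset.sum_congr rfl fun T hT => ?_
    have := card_of_mem_spanningTrees ρ hT
    rw [← this]; push_cast; ring
  have hF2 : ∑ π : Forest V, forestWeight z π *
        (f (inner (forestEdges π.1)) + L * (inner (forestEdges π.1)).card) =
      (∑ π : Forest V, forestWeight z π * f (inner (forestEdges π.1))) +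
        L * (Fintype.card V : ℝ) * (∑ π : Forest V, forestWeight z π) -
        L * ∑ π : Forest V, forestWeight z π * ((roots π.1).card : ℝ) := by
    rw [Finset.mul_sum, Finset.mul_sum, ← Finset.sum_add_distrib, ← Finset.sum_sub_distrib]
    refine Finset.sum_congr rfl fun π _ => ?_
    have := card_inner_add_card_roots π.2
    rw [← this]; push_cast; ring
  rw [hT2, hF2] at key
  simp only [forestMean, treeMean]
  have h3 : 0 < k ρ := hk ρ
  rw [← mul_div_assoc, div_add_div _ _ hT.ne' hZ.ne', div_le_div_iff₀ hZ (mul_pos hT hZ)]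
  revert key
  generalize ∑ π : Forest V, forestWeight z π * f (inner (forestEdges π.1)) = F at *
  generalize ∑ π : Forest V, forestWeight z π * ((roots π.1).card : ℝ) = R at *
  generalize ∑ T ∈ spanningTrees G, treeWeight c T * f T = A at *
  intro key
  have key' : (F + L * (Fintype.card V : ℝ) * (∑ π : Forest V, forestWeight z π) - L * R) *
      partZ G c ≤ (A + L * ((Fintype.card V : ℝ) - 1) * partZ G c) *
        ∑ π : Forest V, forestWeight z π := by
    refine le_of_mul_le_mul_left (a := k ρ) ?_ h3
    linarith
  have h4 : 0 ≤ L * (partZ G c * ∑ π : Forest V, forestWeight z π) := by positivity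
  have h5 : F * partZ G c ≤ A * (∑ π : Forest V, forestWeight z π) + partZ G c * (L * R) := by
    nlinarith
  calc _ = (F * partZ G c) * ∑ π : Forest V, forestWeight z π := by ring
    _ ≤ _ := mul_le_mul_of_nonneg_right h5 hZ.le

/-- The ball of radius `s` around `x`, built step by step. -/
def nbhd (Γ : SimpleGraph V) (x : V) : ℕ → Set V
  | 0 => {x}
  | s + 1 => nbhd Γ x s ∪ {u | ∃ v ∈ nbhd Γ x s, Γ.Adj v u}

lemma nbhd_mono (Γ : SimpleGraph V) (x : V) : Monotone (nbhd Γ x) :=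
  monotone_nat_of_le_succ fun _ => Set.subset_union_left

lemma mem_nbhd_iff_walk {Γ : SimpleGraph V} {x y : V} {s : ℕ} :
    y ∈ nbhd Γ x s ↔ ∃ p : Γ.Walk x y, p.length ≤ s := by
  induction s generalizing y with
  | zero =>
    constructor
    · rintro rfl; exact ⟨.nil, le_rfl⟩
    · rintro ⟨p, hp⟩; exact (SimpleGraph.Walk.eq_of_length_eq_zero (Nat.le_zero.1 hp)).symm
  | succ s ih =>
    constructor
    · rintro (h | ⟨v, hv, hadj⟩)
      · obtain ⟨p, hp⟩ := ih.1 h; exact ⟨p, by omega⟩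
      · obtain ⟨p, hp⟩ := ih.1 hv
        exact ⟨p.concat hadj, by rw [SimpleGraph.Walk.length_concat]; omega⟩
    · rintro ⟨p, hp⟩
      rcases p.length.eq_zero_or_pos with h0 | h0
      · exact Or.inl (ih.2 ⟨p, by omega⟩)
      · right
        have hnil : ¬ p.Nil := fun h => by
          rw [← SimpleGraph.Walk.length_eq_zero_iff] at h; omega
        refine ⟨p.penultimate, ih.2 ⟨p.dropLast, ?_⟩, p.adj_penultimate hnil⟩
        rw [SimpleGraph.Walk.length_dropLast]
        omega

lemma ballSet_eq_nbhd (Γ : SimpleGraph V) (x : V) (s : ℕ) : ballSet Γ x s = nbhd Γ x s := by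
  ext y
  rw [mem_nbhd_iff_walk]
  constructor
  · rintro ⟨h1, h2⟩
    obtain ⟨p, hp⟩ := h1.exists_walk_length_eq_dist
    exact ⟨p, hp ▸ h2⟩
  · rintro ⟨p, hp⟩
    exact ⟨⟨p⟩, (SimpleGraph.dist_le p).trans hp⟩

/-- The vertices at distance less than `r` from `x`. -/
def innerBall (Γ : SimpleGraph V) (x : V) (r : ℕ) : Set V := {u | ∃ s < r, u ∈ nbhd Γ x s}

/-- The graph of the edges touching the open ball of radius `r` around `x`. -/
def truncAt (Γ : SimpleGraph V) (x : V) (r : ℕ) : SimpleGraph V where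
  Adj u v := Γ.Adj u v ∧ (u ∈ innerBall Γ x r ∨ v ∈ innerBall Γ x r)
  symm := ⟨fun _ _ h => ⟨h.1.symm, h.2.symm⟩⟩
  loopless := ⟨fun _ h => h.1.ne rfl⟩

lemma nbhd_congr {Γ Γ' : SimpleGraph V} {x : V} {r : ℕ}
    (h : ∀ u v, u ∈ innerBall Γ x r → (Γ.Adj u v ↔ Γ'.Adj u v)) {s : ℕ} (hs : s ≤ r) :
    nbhd Γ x s = nbhd Γ' x s := by
  induction s with
  | zero => rfl
  | succ s ih =>
    have ih := ih (by omega)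
    simp only [nbhd]
    rw [← ih]
    congr 1
    ext u
    simp only [Set.mem_ofPred_eq]
    refine exists_congr fun v => and_congr_right fun hv => h v u ⟨s, by omega, hv⟩

lemma innerBall_congr {Γ Γ' : SimpleGraph V} {x : V} {r : ℕ}
    (h : ∀ u v, u ∈ innerBall Γ x r → (Γ.Adj u v ↔ Γ'.Adj u v)) :
    innerBall Γ x r = innerBall Γ' x r := by
  ext u
  refine exists_congr fun s => and_congr_right fun hs => ?_
  rw [nbhd_congr h hs.le]

lemma nbhd_truncAt (Γ : SimpleGraph V) (x : V) (r : ℕ) :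
    nbhd (truncAt Γ x r) x r = nbhd Γ x r :=
  (nbhd_congr (Γ := Γ) (Γ' := truncAt Γ x r) (fun _ _ hu => ⟨fun h => ⟨h, Or.inl hu⟩, fun h => h.1⟩) le_rfl).symm

lemma truncAt_congr {Γ Γ' : SimpleGraph V} {x a b : V} {r : ℕ}
    (h : ∀ u v, s(u, v) ≠ s(a, b) → (Γ.Adj u v ↔ Γ'.Adj u v))
    (ha : a ∉ innerBall Γ x r) (hb : b ∉ innerBall Γ x r) :
    truncAt Γ x r = truncAt Γ' x r := by
  have h' : ∀ u v, u ∈ innerBall Γ x r → (Γ.Adj u v ↔ Γ'.Adj u v) := by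
    intro u v hu
    refine h u v fun heq => ?_
    rcases Sym2.eq_iff.1 heq with ⟨rfl, rfl⟩ | ⟨rfl, rfl⟩
    exacts [ha hu, hb hu]
  have hin := innerBall_congr h'
  ext u v
  simp only [truncAt, ← hin]
  constructor
  · rintro ⟨h1, h2 | h2⟩
    · exact ⟨(h' _ _ h2).1 h1, Or.inl h2⟩
    · exact ⟨((h' _ _ h2).1 h1.symm).symm, Or.inr h2⟩
  · rintro ⟨h1, h2 | h2⟩
    · exact ⟨(h' _ _ h2).2 h1, Or.inl h2⟩
    · exact ⟨((h' _ _ h2).2 h1.symm).symm, Or.inr h2⟩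

lemma ballIso_congr {Γ Γ' : SimpleGraph V} {x : V} {r : ℕ} {W : Type} {H : SimpleGraph W} {w : W}
    (hb : ballSet Γ x r = ballSet Γ' x r)
    (hadj : ∀ u v, u ∈ ballSet Γ x r → v ∈ ballSet Γ x r → (Γ.Adj u v ↔ Γ'.Adj u v))
    (h : BallIso Γ x r H w) : BallIso Γ' x r H w := by
  obtain ⟨φ, hφ⟩ := h
  let ψ : SimpleGraph.induce (ballSet Γ' x r) Γ' ≃g SimpleGraph.induce (ballSet Γ x r) Γ :=
    { toEquiv := Equiv.setCongr hb.symm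
      map_rel_iff' := by
        rintro ⟨u, hu⟩ ⟨v, hv⟩
        exact hadj u v (hb ▸ hu) (hb ▸ hv) }
  exact ⟨ψ.trans φ, hφ⟩

lemma ballIso_truncAt_iff {Γ : SimpleGraph V} (hΓ : Γ.IsTree) {x : V} {r : ℕ} {W : Type}
    {H : SimpleGraph W} {w : W} : BallIso (truncAt Γ x r) x r H w ↔ BallIso Γ x r H w := by
  have hb : ballSet (truncAt Γ x r) x r = ballSet Γ x r := by
    rw [ballSet_eq_nbhd, ballSet_eq_nbhd, nbhd_truncAt]
  have hadj : ∀ u v, u ∈ ballSet Γ x r → v ∈ ballSet Γ x r →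
      (Γ.Adj u v ↔ (truncAt Γ x r).Adj u v) := by
    intro u v hu hv
    refine ⟨fun h => ⟨h, ?_⟩, fun h => h.1⟩
    have hlt : ∀ y, y ∈ ballSet Γ x r → Γ.dist x y < r → y ∈ innerBall Γ x r := by
      intro y hy hlt
      exact ⟨_, hlt, by rw [← ballSet_eq_nbhd]; exact ⟨hy.1, le_rfl⟩⟩
    have hne := hΓ.dist_ne_of_adj x h
    rcases lt_or_eq_of_le hu.2 with h1 | h1
    · exact Or.inl (hlt u hu h1)
    · rcases lt_or_eq_of_le hv.2 with h2 | h2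
      · exact Or.inr (hlt v hv h2)
      · exact absurd (h1.trans h2.symm) hne
  constructor
  · exact ballIso_congr hb fun u v hu hv => (hadj u v (hb ▸ hu) (hb ▸ hv)).symm
  · exact ballIso_congr hb.symm hadj

lemma ncard_centers_le (Γ : SimpleGraph V) (m : ℕ) (s : ℕ) (a : V) :
    {x | a ∈ nbhd Γ x s ∧ ∀ u ∈ nbhd Γ x s, (Γ.neighborSet u).ncard ≤ m}.ncard ≤ (m + 1) ^ s := by
  classical
  induction s generalizing a with
  | zero =>
    refine (Set.ncard_le_ncard (t := {a}) ?_ (Set.toFinite _)).trans (by simp)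
    rintro x ⟨h, -⟩
    exact (Set.mem_singleton_iff.1 h).symm
  | succ s ih =>
    by_cases hm : (Γ.neighborSet a).ncard ≤ m
    · have hsub : {x | a ∈ nbhd Γ x (s + 1) ∧
          ∀ u ∈ nbhd Γ x (s + 1), (Γ.neighborSet u).ncard ≤ m} ⊆
          {x | a ∈ nbhd Γ x s ∧ ∀ u ∈ nbhd Γ x s, (Γ.neighborSet u).ncard ≤ m} ∪
          ⋃ v ∈ (Γ.neighborSet a).toFinset,
            {x | v ∈ nbhd Γ x s ∧ ∀ u ∈ nbhd Γ x s, (Γ.neighborSet u).ncard ≤ m} := by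
        rintro x ⟨h | ⟨v, hv, hadj⟩, h2⟩
        · exact Or.inl ⟨h, fun u hu => h2 u (Or.inl hu)⟩
        · right
          simp only [Set.mem_iUnion]
          exact ⟨v, by simpa using hadj.symm, hv, fun u hu => h2 u (Or.inl hu)⟩
      refine (Set.ncard_le_ncard hsub (Set.toFinite _)).trans ((Set.ncard_union_le _ _).trans ?_)
      have h3 := Finset.set_ncard_biUnion_le (Γ.neighborSet a).toFinset
        (fun v => {x | v ∈ nbhd Γ x s ∧ ∀ u ∈ nbhd Γ x s, (Γ.neighborSet u).ncard ≤ m})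
      have h4 : ∑ v ∈ (Γ.neighborSet a).toFinset,
          {x | v ∈ nbhd Γ x s ∧ ∀ u ∈ nbhd Γ x s, (Γ.neighborSet u).ncard ≤ m}.ncard ≤
          m * (m + 1) ^ s := by
        refine (Finset.sum_le_sum fun v _ => ih v).trans ?_
        rw [Finset.sum_const, smul_eq_mul, ← Set.ncard_eq_toFinset_card']
        exact Nat.mul_le_mul_right _ hm
      calc _ ≤ (m + 1) ^ s + m * (m + 1) ^ s := add_le_add (ih a) (h3.trans h4)
        _ = (m + 1) ^ (s + 1) := by ring
    · have : {x | a ∈ nbhd Γ x (s + 1) ∧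
          ∀ u ∈ nbhd Γ x (s + 1), (Γ.neighborSet u).ncard ≤ m} = ∅ :=
        Set.eq_empty_of_forall_notMem fun x hx => hm (hx.2 a hx.1)
      rw [this]; simp

lemma degree_le_of_ballIso {Γ : SimpleGraph V} {x : V} {r m : ℕ} {H : SimpleGraph (Fin m)}
    {w : Fin m} (h : BallIso (truncAt Γ x r) x r H w) {u : V} (hu : u ∈ innerBall Γ x r) :
    (Γ.neighborSet u).ncard ≤ m := by
  obtain ⟨φ, -⟩ := h
  have h1 : (ballSet (truncAt Γ x r) x r).ncard = m := by
    rw [← Nat.card_coe_set_eq, Nat.card_congr φ.toEquiv, Nat.card_eq_fintype_card,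
      Fintype.card_fin]
  rw [← h1, ballSet_eq_nbhd, nbhd_truncAt]
  refine Set.ncard_le_ncard (fun v hv => ?_) (Set.toFinite _)
  obtain ⟨s, hs, hus⟩ := hu
  exact nbhd_mono Γ x (Nat.succ_le_of_lt hs) (Or.inr ⟨u, hus, hv⟩)

lemma ncard_ballIso_le (Γ : SimpleGraph V) {r m : ℕ} (H : SimpleGraph (Fin m)) (w : Fin m)
    (a : V) :
    {x | BallIso (truncAt Γ x r) x r H w ∧ a ∈ innerBall Γ x r}.ncard ≤ (m + 1) ^ r := by
  rcases r with _ | r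
  · have : {x | BallIso (truncAt Γ x 0) x 0 H w ∧ a ∈ innerBall Γ x 0} = ∅ :=
      Set.eq_empty_of_forall_notMem fun x hx => by
        obtain ⟨s, hs, -⟩ := hx.2; omega
    rw [this]; simp
  · refine (Set.ncard_le_ncard ?_ (Set.toFinite _)).trans ((ncard_centers_le Γ m r a).trans
      (Nat.pow_le_pow_right (by omega) (by omega)))
    rintro x ⟨h1, s, hs, h2⟩
    exact ⟨nbhd_mono Γ x (Nat.le_of_lt_succ hs) h2,
      fun u hu => degree_le_of_ballIso h1 ⟨r, by omega, hu⟩⟩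

open scoped Classical in
/-- The number of vertices whose (truncated) `r`-ball is isomorphic to `(H, w)`. -/
def ballCount (r : ℕ) {m : ℕ} (H : SimpleGraph (Fin m)) (w : Fin m) (S : Finset (Sym2 V)) : ℝ :=
  ((univ.filter fun x : V => BallIso
    (truncAt (SimpleGraph.fromEdgeSet (↑S : Set (Sym2 V))) x r) x r H w).card : ℝ)

lemma card_filter_ballIso_le {Γ Γ' : SimpleGraph V} {a b : V} {r m : ℕ}
    (h : ∀ u v, s(u, v) ≠ s(a, b) → (Γ.Adj u v ↔ Γ'.Adj u v))
    (H : SimpleGraph (Fin m)) (w : Fin m) [DecidablePred fun x => BallIso (truncAt Γ x r) x r H w]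
    [DecidablePred fun x => BallIso (truncAt Γ' x r) x r H w] :
    (univ.filter fun x => BallIso (truncAt Γ x r) x r H w).card ≤
      (univ.filter fun x => BallIso (truncAt Γ' x r) x r H w).card + 2 * (m + 1) ^ r := by
  rw [← Set.ncard_coe_finset, ← Set.ncard_coe_finset]
  have hsub : (↑(univ.filter fun x => BallIso (truncAt Γ x r) x r H w) : Set V) ⊆
      ↑(univ.filter fun x => BallIso (truncAt Γ' x r) x r H w) ∪
      ({x | BallIso (truncAt Γ x r) x r H w ∧ a ∈ innerBall Γ x r} ∪
      {x | BallIso (truncAt Γ x r) x r H w ∧ b ∈ innerBall Γ x r}) := by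
    intro x hx
    have hx : BallIso (truncAt Γ x r) x r H w := by simpa using hx
    by_cases ha : a ∈ innerBall Γ x r
    · exact Or.inr (Or.inl ⟨hx, ha⟩)
    by_cases hb : b ∈ innerBall Γ x r
    · exact Or.inr (Or.inr ⟨hx, hb⟩)
    · left
      rw [truncAt_congr h ha hb] at hx
      simpa using hx
  have h1 := Set.ncard_le_ncard hsub (Set.toFinite _)
  have h2 := Set.ncard_union_le (↑(univ.filter fun x => BallIso (truncAt Γ' x r) x r H w) : Set V)
    ({x | BallIso (truncAt Γ x r) x r H w ∧ a ∈ innerBall Γ x r} ∪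
      {x | BallIso (truncAt Γ x r) x r H w ∧ b ∈ innerBall Γ x r})
  have h3 := Set.ncard_union_le {x | BallIso (truncAt Γ x r) x r H w ∧ a ∈ innerBall Γ x r}
    {x | BallIso (truncAt Γ x r) x r H w ∧ b ∈ innerBall Γ x r}
  have h4 := ncard_ballIso_le Γ (r := r) H w a
  have h5 := ncard_ballIso_le Γ (r := r) H w b
  omega

lemma fromEdgeSet_insert_adj (S : Finset (Sym2 V)) {a b u v : V} (h : s(u, v) ≠ s(a, b)) :
    (SimpleGraph.fromEdgeSet (↑S : Set (Sym2 V))).Adj u v ↔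
      (SimpleGraph.fromEdgeSet (↑(insert s(a, b) S) : Set (Sym2 V))).Adj u v := by
  simp [SimpleGraph.fromEdgeSet_adj, h]

lemma ballCount_insert (r : ℕ) {m : ℕ} (H : SimpleGraph (Fin m)) (w : Fin m) (e : Sym2 V)
    (S : Finset (Sym2 V)) :
    |ballCount r H w (insert e S) - ballCount r H w S| ≤ 2 * ((m : ℝ) + 1) ^ r := by
  classical
  induction e using Sym2.inductionOn with | _ a b =>
  have h1 := card_filter_ballIso_le (r := r)
    (fun u v h => fromEdgeSet_insert_adj S (a := a) (b := b) h) H w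
  have h2 := card_filter_ballIso_le (r := r)
    (fun u v h => (fromEdgeSet_insert_adj S (a := a) (b := b) h).symm) H w
  rw [abs_le]
  simp only [ballCount]
  constructor
  · have := (Nat.cast_le (α := ℝ)).2 h1
    push_cast at this ⊢
    linarith
  · have := (Nat.cast_le (α := ℝ)).2 h2
    push_cast at this ⊢
    linarith

lemma wstBallProb_eq (G : SimpleGraph V) (c : Sym2 V → ℝ) (r : ℕ) {m : ℕ}
    (H : SimpleGraph (Fin m)) (w : Fin m) :
    wstBallProb G c r H w = (Fintype.card V : ℝ)⁻¹ * treeMean G c (ballCount r H w) := by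
  classical
  rw [wstBallProb, treeMean, ← Finset.sum_div, Finset.sum_comm]
  congr 2
  refine Finset.sum_congr rfl fun T hT => ?_
  have htree := (Finset.mem_filter.1 hT).2.2
  rw [ballCount, ← Finset.sum_filter, Finset.sum_const, nsmul_eq_mul, mul_comm]
  congr 3
  ext x
  simp only [mem_filter, mem_univ, true_and]
  exact (ballIso_truncAt_iff htree).symm

/-- Functions on maps that change by at most `ℓ` when one value is changed. -/
def HamLip (ℓ : ℝ) (h : (V → Option V) → ℝ) : Prop :=
  ∀ π v o, |h (Function.update π v o) - h π| ≤ ℓ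

lemma inner_forestEdges_cases (π : V → Option V) (v : V) :
    ∃ S : Finset (Sym2 V), ∀ o, inner (forestEdges (Function.update π v o)) = S ∨
      ∃ e, inner (forestEdges (Function.update π v o)) = insert e S := by
  refine ⟨inner ((univ.erase v).image fun u => s(some u, π u)), fun o => ?_⟩
  have h1 : forestEdges (Function.update π v o) =
      insert s(some v, o) ((univ.erase v).image fun u => s(some u, π u)) := by
    have hu : (univ : Finset V) = insert v (univ.erase v) :=
      (Finset.insert_erase (mem_univ v)).symm
    rw [forestEdges, hu, Finset.image_insert, ← hu]
    congr 1
    · simp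
    · refine Finset.image_congr fun u hu => ?_
      have : u ≠ v := by simpa using hu
      simp [this]
  rw [h1]
  rcases o with _ | u
  · left
    ext e
    induction e using Sym2.inductionOn with | _ x y =>
    simp [inner]
  · right
    exact ⟨s(v, u), inner_insert_map s(v, u) _⟩

lemma hamLip_of_insert {f : Finset (Sym2 V) → ℝ} {L : ℝ} (hL : 0 ≤ L)
    (hf : ∀ e S, |f (insert e S) - f S| ≤ L) :
    HamLip (2 * L) fun π : V → Option V => f (inner (forestEdges π)) := by
  intro π v o
  obtain ⟨S, hS⟩ := inner_forestEdges_cases π v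
  have h : ∀ o, |f (inner (forestEdges (Function.update π v o))) - f S| ≤ L := by
    intro o
    rcases hS o with h | ⟨e, h⟩
    · rw [h]; simpa using hL
    · rw [h]; exact hf e S
  have h1 := abs_le.1 (h o)
  have h2 := h (π v)
  rw [Function.update_eq_self] at h2
  have h2 := abs_le.1 h2
  rw [abs_le]
  constructor <;> linarith [h1.1, h1.2, h2.1, h2.2]

lemma hamLip_card_roots : HamLip 1 fun π : V → Option V => ((roots π).card : ℝ) := by
  intro π v o
  have h : ∀ o, roots (Function.update π v o) = (roots π).erase v ∪ if o = none then {v} else ∅ := by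
    intro o
    ext u
    by_cases huv : u = v
    · subst huv; split_ifs with ho <;> simp [roots, ho]
    · split_ifs with ho <;> simp [roots, huv]
  have key : ∀ o, ((roots π).erase v).card ≤ (roots (Function.update π v o)).card ∧
      (roots (Function.update π v o)).card ≤ ((roots π).erase v).card + 1 := by
    intro o
    rw [h o]
    refine ⟨Finset.card_le_card Finset.subset_union_left, (Finset.card_union_le _ _).trans ?_⟩
    split_ifs <;> simp
  have k1 := key o
  have k2 := key (π v)
  rw [Function.update_eq_self] at k2
  have e1 := (Nat.cast_le (α := ℝ)).2 k1.1
  have e2 := (Nat.cast_le (α := ℝ)).2 k1.2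
  have e3 := (Nat.cast_le (α := ℝ)).2 k2.1
  have e4 := (Nat.cast_le (α := ℝ)).2 k2.2
  push_cast at e2 e4
  rw [abs_le]
  constructor <;> linarith

/-- Weighted sum over all maps with independent values. -/
def prodMean (p : V → Option V → ℝ) (Φ : (V → Option V) → ℝ) : ℝ :=
  ∑ π : V → Option V, (∏ v, p v (π v)) * Φ π

lemma sum_swap_coord (v : V) (F : (V → Option V) → Option V → ℝ) :
    ∑ π, ∑ o, F π o = ∑ π, ∑ o, F (Function.update π v o) (π v) := by
  rw [← Fintype.sum_prod_type', ← Fintype.sum_prod_type']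
  let σ : (V → Option V) × Option V → (V → Option V) × Option V :=
    fun q => (Function.update q.1 v q.2, q.1 v)
  have hσ : Function.Involutive σ := fun q => by simp [σ]
  exact (Equiv.sum_comp hσ.toPerm (fun q : (V → Option V) × Option V => F q.1 q.2)).symm

lemma prod_update_eq (p : V → Option V → ℝ) (π : V → Option V) (v : V) (o : Option V) :
    (∏ u, p u (Function.update π v o u)) = p v o * ∏ u ∈ univ.erase v, p u (π u) := by
  rw [← Finset.mul_prod_erase _ _ (mem_univ v), Function.update_self]
  congr 1
  refine Finset.prod_congr rfl fun u hu => ?_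
  rw [Function.update_of_ne (Finset.ne_of_mem_erase hu)]

lemma prodMean_avg {p : V → Option V → ℝ} (hp : ∀ v, ∑ o, p v o = 1) (v : V)
    (Φ : (V → Option V) → ℝ) :
    prodMean p (fun π => ∑ o, p v o * Φ (Function.update π v o)) = prodMean p Φ := by
  unfold prodMean
  simp only [Finset.mul_sum]
  rw [sum_swap_coord v]
  refine Finset.sum_congr rfl fun π _ => ?_
  calc _ = ∑ o, p v o * ((∏ u, p u (π u)) * Φ π) := by
        refine Finset.sum_congr rfl fun o _ => ?_
        rw [Function.update_idem, Function.update_eq_self, prod_update_eq,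
          ← Finset.mul_prod_erase univ (fun u => p u (π u)) (mem_univ v)]
        ring
    _ = _ := by rw [← Finset.sum_mul, hp, one_mul]

lemma sum_prod_eq_one {p : V → Option V → ℝ} (hp : ∀ v, ∑ o, p v o = 1) :
    ∑ π : V → Option V, ∏ v, p v (π v) = 1 := by
  rw [← Fintype.prod_sum]
  simp [hp]

lemma prodMean_mono {p : V → Option V → ℝ} (hp : ∀ v o, 0 ≤ p v o) {Φ Ψ : (V → Option V) → ℝ}
    (h : ∀ π, Φ π ≤ Ψ π) : prodMean p Φ ≤ prodMean p Ψ :=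
  Finset.sum_le_sum fun π _ => mul_le_mul_of_nonneg_left (h π) (Finset.prod_nonneg fun _ _ => hp _ _)

lemma prodMean_const_mul (p : V → Option V → ℝ) (a : ℝ) (Φ : (V → Option V) → ℝ) :
    prodMean p (fun π => a * Φ π) = a * prodMean p Φ := by
  unfold prodMean
  rw [Finset.mul_sum]
  exact Finset.sum_congr rfl fun π _ => by ring

lemma exp_le_one_add_sq {z : ℝ} (hz : |z| ≤ 1) : Real.exp z ≤ 1 + z + z ^ 2 := by
  have := Real.abs_exp_sub_one_sub_id_le hz
  linarith [(abs_le.1 this).2]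

lemma avg_exp_le {ι : Type*} [Fintype ι] {q : ι → ℝ} (hq : ∀ o, 0 ≤ q o) (hq1 : ∑ o, q o = 1)
    {ℓ : ℝ} (hℓ : ℓ ≤ 1) {y : ι → ℝ} (hy : ∀ o o', |y o - y o'| ≤ ℓ) :
    ∑ o, q o * Real.exp (y o) ≤ Real.exp (ℓ ^ 2) * Real.exp (∑ o, q o * y o) := by
  set μ := ∑ o, q o * y o with hμ
  have hdev : ∀ o, |y o - μ| ≤ ℓ := by
    intro o
    have : y o - μ = ∑ o', q o' * (y o - y o') := by
      simp only [mul_sub, Finset.sum_sub_distrib, ← Finset.sum_mul, hq1, one_mul, hμ]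
    rw [this]
    refine (Finset.abs_sum_le_sum_abs _ _).trans ?_
    calc _ ≤ ∑ o', q o' * ℓ := by
          refine Finset.sum_le_sum fun o' _ => ?_
          rw [abs_mul, abs_of_nonneg (hq o')]
          exact mul_le_mul_of_nonneg_left (hy o o') (hq o')
      _ = ℓ := by rw [← Finset.sum_mul, hq1, one_mul]
  have h1 : ∑ o, q o * Real.exp (y o - μ) ≤ 1 + ℓ ^ 2 := by
    calc _ ≤ ∑ o, q o * (1 + (y o - μ) + ℓ ^ 2) := by
          refine Finset.sum_le_sum fun o _ => mul_le_mul_of_nonneg_left ?_ (hq o)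
          have h2 := exp_le_one_add_sq ((hdev o).trans hℓ)
          have h3 : (y o - μ) ^ 2 ≤ ℓ ^ 2 := sq_le_sq' (by linarith [(abs_le.1 (hdev o)).1])
            (abs_le.1 (hdev o)).2
          linarith
      _ = _ := by
          simp only [mul_add, mul_sub, Finset.sum_add_distrib, Finset.sum_sub_distrib,
            ← Finset.sum_mul, hq1, ← hμ]
          ring
  have h2 : ∑ o, q o * Real.exp (y o) = (∑ o, q o * Real.exp (y o - μ)) * Real.exp μ := by
    rw [Finset.sum_mul]
    refine Finset.sum_congr rfl fun o _ => ?_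
    rw [mul_assoc, ← Real.exp_add]; simp
  rw [h2]
  refine mul_le_mul_of_nonneg_right (h1.trans ?_) (Real.exp_pos _).le
  linarith [Real.add_one_le_exp (ℓ ^ 2)]

lemma prodMean_exp_le_aux {p : V → Option V → ℝ} (hp : ∀ v o, 0 ≤ p v o)
    (hp1 : ∀ v, ∑ o, p v o = 1) {ℓ : ℝ} (hℓ : ℓ ≤ 1) (s : Finset V) (y : (V → Option V) → ℝ)
    (hy : HamLip ℓ y) (hs : DependsOn y (↑s : Set V)) :
    prodMean p (fun π => Real.exp (y π)) ≤
      Real.exp (prodMean p y + s.card * ℓ ^ 2) := by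
  induction s using Finset.induction_on generalizing y with
  | empty =>
    have hc : ∀ π, y π = y fun _ => none := fun π => hs (by simp)
    have h1 : ∀ a : ℝ, prodMean p (fun _ => a) = a := fun a => by
      unfold prodMean
      rw [← Finset.sum_mul, sum_prod_eq_one hp1, one_mul]
    have h2 : y = fun _ => y fun _ => none := funext hc
    rw [h2]
    simp [h1]
  | insert v s hv ih =>
    set y' : (V → Option V) → ℝ := fun π => ∑ o, p v o * y (Function.update π v o) with hy'
    have hlip : HamLip ℓ y' := by
      intro π u o
      simp only [hy', ← Finset.sum_sub_distrib, ← mul_sub]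
      refine (Finset.abs_sum_le_sum_abs _ _).trans ?_
      calc _ ≤ ∑ o', p v o' * ℓ := by
            refine Finset.sum_le_sum fun o' _ => ?_
            rw [abs_mul, abs_of_nonneg (hp v o')]
            refine mul_le_mul_of_nonneg_left ?_ (hp v o')
            by_cases huv : u = v
            · subst huv
              rw [Function.update_idem]
              simpa using (abs_nonneg _).trans (hy π u o)
            · rw [Function.update_comm huv]
              exact hy _ _ _
        _ = ℓ := by rw [← Finset.sum_mul, hp1, one_mul]
    have hdep : DependsOn y' (↑s : Set V) := by
      intro π π' h
      refine Finset.sum_congr rfl fun o _ => ?_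
      congr 1
      refine hs fun u hu => ?_
      by_cases huv : u = v
      · subst huv; simp
      · rw [Function.update_of_ne huv, Function.update_of_ne huv]
        exact h u (by simpa [huv] using hu)
    have h1 := ih y' hlip hdep
    calc prodMean p (fun π => Real.exp (y π))
        = prodMean p (fun π => ∑ o, p v o * Real.exp (y (Function.update π v o))) :=
          (prodMean_avg hp1 v _).symm
      _ ≤ prodMean p (fun π => Real.exp (ℓ ^ 2) * Real.exp (y' π)) := by
          refine prodMean_mono hp fun π => avg_exp_le (hp v) (hp1 v) hℓ fun o o' => ?_
          have := hy (Function.update π v o') v o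
          rwa [Function.update_idem] at this
      _ ≤ Real.exp (ℓ ^ 2) * Real.exp (prodMean p y' + s.card * ℓ ^ 2) := by
          rw [prodMean_const_mul]
          exact mul_le_mul_of_nonneg_left h1 (Real.exp_pos _).le
      _ = _ := by
          rw [← Real.exp_add, hy', prodMean_avg hp1, Finset.card_insert_of_notMem hv]
          push_cast; ring_nf

/-- Exponential moments of functions with bounded differences. -/
lemma prodMean_exp_le {p : V → Option V → ℝ} (hp : ∀ v o, 0 ≤ p v o)
    (hp1 : ∀ v, ∑ o, p v o = 1) {ℓ : ℝ} (hℓ : ℓ ≤ 1) {y : (V → Option V) → ℝ}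
    (hy : HamLip ℓ y) :
    prodMean p (fun π => Real.exp (y π)) ≤
      Real.exp (prodMean p y + Fintype.card V * ℓ ^ 2) :=
  prodMean_exp_le_aux hp hp1 hℓ univ y hy fun _ _ h => congrArg y (funext fun v => h v (by simp))

lemma exp_neg_le_one_sub {x θ : ℝ} (hθ : θ < 1) (hx : x ≤ θ) :
    Real.exp (-x - (1 - θ)⁻¹ * x ^ 2) ≤ 1 - x := by
  have h1 : 0 < 1 - x := by linarith
  have h2 : 1 / (1 - x) ≤ Real.exp (x / (1 - x)) := by
    have := Real.add_one_le_exp (x / (1 - x))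
    have h3 : x / (1 - x) + 1 = 1 / (1 - x) := by field_simp; ring
    linarith
  have h4 : x / (1 - x) ≤ x + (1 - θ)⁻¹ * x ^ 2 := by
    have h5 : x / (1 - x) = x + (1 - x)⁻¹ * x ^ 2 := by field_simp; ring
    rw [h5]
    have : (1 - x)⁻¹ ≤ (1 - θ)⁻¹ := inv_anti₀ (by linarith) (by linarith)
    gcongr
  have h6 : 1 / (1 - x) ≤ Real.exp (x + (1 - θ)⁻¹ * x ^ 2) := h2.trans (Real.exp_le_exp.2 h4)
  have h7 : -x - (1 - θ)⁻¹ * x ^ 2 = -(x + (1 - θ)⁻¹ * x ^ 2) := by ring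
  rw [h7, Real.exp_neg]
  rw [div_le_iff₀ h1] at h6
  rw [inv_le_iff_one_le_mul₀ (Real.exp_pos _)]
  linarith

lemma trace_sq_eq_sum_eigenvalues_sq {N : Matrix V V ℝ} (hN : N.IsHermitian) :
    (N * N).trace = ∑ i, hN.eigenvalues i ^ 2 := by
  have h := hN.spectral_theorem
  have h2 : N * N = Unitary.conjStarAlgAut ℝ _ hN.eigenvectorUnitary
      (Matrix.diagonal (RCLike.ofReal ∘ hN.eigenvalues) * Matrix.diagonal (RCLike.ofReal ∘ hN.eigenvalues)) := by
    rw [map_mul, ← h]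
  rw [h2, Unitary.conjStarAlgAut_apply, Matrix.trace_mul_cycle]
  simp [Matrix.trace_diagonal, pow_two]

lemma eigenvalues_le_one {N : Matrix V V ℝ} (hN : N.IsHermitian)
    (h : ∀ x : V → ℝ, x ⬝ᵥ N.mulVec x ≤ x ⬝ᵥ x) (i : V) : hN.eigenvalues i ≤ 1 := by
  set x : V → ℝ := ⇑(hN.eigenvectorBasis i) with hx
  have h1 := hN.mulVec_eigenvectorBasis i
  have h2 := h x
  rw [hx, h1, ← hx, dotProduct_smul, smul_eq_mul] at h2
  have h3 : 0 < x ⬝ᵥ x := by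
    have hne : x ≠ 0 := by
      intro h0
      have h4 := hN.eigenvectorBasis.orthonormal.ne_zero i
      apply h4
      ext j
      exact congrFun h0 j
    rcases Function.ne_iff.1 hne with ⟨j, hj⟩
    exact Finset.sum_pos' (fun _ _ => mul_self_nonneg _) ⟨j, mem_univ _, mul_self_pos.2 hj⟩
  nlinarith

lemma exp_le_det_one_sub {N : Matrix V V ℝ} (hN : N.IsHermitian) (h0 : N.trace = 0)
    (h : ∀ x : V → ℝ, x ⬝ᵥ N.mulVec x ≤ x ⬝ᵥ x) {κ : ℝ} (hκ : 0 < κ) :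
    (1 + κ) ^ Fintype.card V * Real.exp (-((1 + κ) / κ * (N * N).trace)) ≤
      (Matrix.scalar V (1 + κ) - N).det := by
  rw [← Matrix.eval_charpoly, hN.charpoly_eq, Polynomial.eval_prod]
  simp only [Polynomial.eval_sub, Polynomial.eval_X, Polynomial.eval_C, RCLike.ofReal_real_eq_id, id]
  have htr : ∑ i, hN.eigenvalues i = 0 := by
    have := hN.trace_eq_sum_eigenvalues
    rw [h0] at this
    simpa using this.symm
  have h1 : ∀ i, (1 + κ) * Real.exp (-(hN.eigenvalues i / (1 + κ)) -
      (1 - (1 + κ)⁻¹)⁻¹ * (hN.eigenvalues i / (1 + κ)) ^ 2) ≤ 1 + κ - hN.eigenvalues i := by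
    intro i
    have h2 : (1 + κ)⁻¹ < 1 := inv_lt_one_of_one_lt₀ (by linarith)
    have h3 : hN.eigenvalues i / (1 + κ) ≤ (1 + κ)⁻¹ := by
      rw [div_eq_mul_inv]
      exact mul_le_of_le_one_left (by positivity) (eigenvalues_le_one hN h i)
    have h4 := exp_neg_le_one_sub h2 h3
    calc _ ≤ (1 + κ) * (1 - hN.eigenvalues i / (1 + κ)) :=
          mul_le_mul_of_nonneg_left h4 (by linarith)
      _ = _ := by field_simp
  refine le_trans ?_ (Finset.prod_le_prod (fun i _ => by positivity) fun i _ => h1 i)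
  rw [Finset.prod_mul_distrib, Finset.prod_const, Finset.card_univ, ← Real.exp_sum]
  refine mul_le_mul_of_nonneg_left (Real.exp_le_exp.2 ?_) (by positivity)
  rw [Finset.sum_sub_distrib, Finset.sum_neg_distrib, ← Finset.sum_div, htr, ← Finset.mul_sum,
    trace_sq_eq_sum_eigenvalues_sq hN]
  simp only [div_pow, ← Finset.sum_div]
  have h5 : (1 - (1 + κ)⁻¹)⁻¹ = (1 + κ) / κ := by
    have : 1 - (1 + κ)⁻¹ = κ / (1 + κ) := by field_simp; ring
    rw [this, inv_div]
  rw [h5]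
  have h6 : (∑ i, hN.eigenvalues i ^ 2) / (1 + κ) ^ 2 ≤ ∑ i, hN.eigenvalues i ^ 2 :=
    div_le_self (by positivity) (by nlinarith)
  have h7 : 0 ≤ (1 + κ) / κ := by positivity
  have h8 := mul_le_mul_of_nonneg_left h6 h7
  rw [zero_div, neg_zero]
  linarith

/-- A quantitative lower bound for the determinant of a killed Laplacian. -/
lemma det_killedLap_ge {a : V → V → ℝ} (ha : ∀ v u, 0 ≤ a v u) (hs : ∀ v u, a v u = a u v)
    (hd : ∀ v, a v v = 0) {C : V → ℝ} (hC : ∀ v, C v = ∑ u, a v u) (hC0 : ∀ v, 0 < C v)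
    {κ : ℝ} (hκ : 0 < κ) :
    (∏ v, ((1 + κ) * C v)) * Real.exp (-((1 + κ) / κ * ∑ v, ∑ u, a v u ^ 2 / (C v * C u))) ≤
      (killedLap fun v o => Option.elim o (κ * C v) (a v)).det := by
  set s : V → ℝ := fun v => √(C v) with hsdef
  have hs0 : ∀ v, 0 < s v := fun v => Real.sqrt_pos.2 (hC0 v)
  have hss : ∀ v, s v * s v = C v := fun v => Real.mul_self_sqrt (hC0 v).le
  set N : Matrix V V ℝ := Matrix.of fun v u => a v u / (s v * s u) with hNdef
  have hN : N.IsHermitian := by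
    ext v u
    simp only [hNdef, Matrix.conjTranspose_apply, Matrix.of_apply, star_trivial]
    rw [hs u v, mul_comm]
  have h0 : N.trace = 0 := by simp [hNdef, Matrix.trace, hd]
  have hq : ∀ x : V → ℝ, x ⬝ᵥ N.mulVec x ≤ x ⬝ᵥ x := by
    intro x
    have h1 : x ⬝ᵥ N.mulVec x = ∑ v, ∑ u, a v u * ((x v / s v) * (x u / s u)) := by
      simp only [dotProduct, Matrix.mulVec, hNdef, Matrix.of_apply, Finset.mul_sum]
      refine Finset.sum_congr rfl fun v _ => Finset.sum_congr rfl fun u _ => ?_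
      have := (hs0 v).ne'; have := (hs0 u).ne'
      field_simp
    have h2 : x ⬝ᵥ x = ∑ v, ∑ u, a v u * (x v / s v) ^ 2 := by
      simp only [dotProduct, ← Finset.sum_mul, ← hC]
      refine Finset.sum_congr rfl fun v _ => ?_
      have := (hs0 v).ne'
      rw [← hss]; field_simp
    have h3 : x ⬝ᵥ x = ∑ v, ∑ u, a v u * (x u / s u) ^ 2 := by
      rw [h2, Finset.sum_comm]
      exact Finset.sum_congr rfl fun v _ => Finset.sum_congr rfl fun u _ => by rw [hs]
    have h4 : x ⬝ᵥ N.mulVec x ≤ (x ⬝ᵥ x + x ⬝ᵥ x) / 2 := by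
      rw [h1]
      nth_rewrite 1 [h2]
      rw [h3, ← Finset.sum_add_distrib, Finset.sum_div]
      refine Finset.sum_le_sum fun v _ => ?_
      rw [← Finset.sum_add_distrib, Finset.sum_div]
      refine Finset.sum_le_sum fun u _ => ?_
      nlinarith [mul_nonneg (ha v u) (sq_nonneg (x v / s v - x u / s u))]
    linarith
  have hdet := exp_le_det_one_sub hN h0 hq hκ
  have htr : (N * N).trace = ∑ v, ∑ u, a v u ^ 2 / (C v * C u) := by
    simp only [Matrix.trace, Matrix.diag, Matrix.mul_apply, hNdef, Matrix.of_apply]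
    refine Finset.sum_congr rfl fun v _ => Finset.sum_congr rfl fun u _ => ?_
    rw [hs u v, ← hss, ← hss]
    have := (hs0 v).ne'; have := (hs0 u).ne'
    field_simp
  have hfac : (killedLap fun v o => Option.elim o (κ * C v) (a v)) =
      Matrix.diagonal s * (Matrix.scalar V (1 + κ) - N) * Matrix.diagonal s := by
    ext v u
    rw [Matrix.mul_diagonal, Matrix.diagonal_mul]
    simp only [killedLap, Matrix.of_apply, Fintype.sum_option, Option.elim, ← hC, Matrix.sub_apply,
      hNdef, Matrix.scalar_apply, Matrix.diagonal_apply]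
    have := (hs0 v).ne'; have := (hs0 u).ne'
    by_cases hvu : v = u
    · subst hvu
      simp only [if_true]
      rw [hd, ← hss]; field_simp; ring
    · simp only [hvu, if_false]; field_simp; ring
  rw [hfac, Matrix.det_mul, Matrix.det_mul, Matrix.det_diagonal, ← htr]
  have hprod : ∏ v, ((1 + κ) * C v) = (∏ v, s v) * (1 + κ) ^ Fintype.card V * ∏ v, s v := by
    rw [Finset.prod_mul_distrib, Finset.prod_const, Finset.card_univ]
    simp only [← hss, Finset.prod_mul_distrib]; ring
  rw [hprod]
  have hp : 0 < ∏ v, s v := Finset.prod_pos fun v _ => hs0 v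
  calc _ = (∏ v, s v) * ((1 + κ) ^ Fintype.card V *
        Real.exp (-((1 + κ) / κ * (N * N).trace))) * ∏ v, s v := by ring
    _ ≤ _ := by gcongr

lemma prodMean_update {p : V → Option V → ℝ} {v : V} (hp : ∑ o, p v o = 1) {r : Option V → ℝ}
    (hr : ∑ o, r o = 1) {Φ : (V → Option V) → ℝ}
    (hΦ : ∀ π o, Φ (Function.update π v o) = Φ π) :
    prodMean p Φ = prodMean (Function.update p v r) Φ := by
  have hfac : ∀ π : V → Option V, ∏ u, Function.update p v r u (π u) =
      r (π v) * ∏ u ∈ univ.erase v, p u (π u) := by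
    intro π
    rw [← Finset.mul_prod_erase _ _ (mem_univ v), Function.update_self]
    congr 1
    refine Finset.prod_congr rfl fun u hu => ?_
    rw [Function.update_of_ne (Finset.ne_of_mem_erase hu)]
  have her : ∀ (π : V → Option V) (o : Option V),
      ∏ u ∈ univ.erase v, p u (Function.update π v o u) = ∏ u ∈ univ.erase v, p u (π u) := by
    intro π o
    refine Finset.prod_congr rfl fun u hu => ?_
    rw [Function.update_of_ne (Finset.ne_of_mem_erase hu)]
  have key := sum_swap_coord v
    (fun π o => p v (π v) * (r o * (∏ u ∈ univ.erase v, p u (π u)) * Φ π))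
  calc prodMean p Φ = ∑ π : V → Option V, ∑ o,
        p v (π v) * (r o * (∏ u ∈ univ.erase v, p u (π u)) * Φ π) := by
        refine Finset.sum_congr rfl fun π _ => ?_
        simp only [← Finset.mul_sum, ← Finset.sum_mul, hr]
        rw [← Finset.mul_prod_erase univ (fun u => p u (π u)) (mem_univ v)]
        ring
    _ = _ := by
        rw [key]
        refine Finset.sum_congr rfl fun π _ => ?_
        simp only [Function.update_self, her, hΦ, hfac, ← Finset.sum_mul, hp, one_mul]

lemma prodMean_congr_off {p p' : V → Option V → ℝ} (B : Finset V) (hp : ∀ v, ∑ o, p v o = 1)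
    (hp' : ∀ v, ∑ o, p' v o = 1) (h : ∀ v ∉ B, p v = p' v) {Φ : (V → Option V) → ℝ}
    (hΦ : ∀ v ∈ B, ∀ π o, Φ (Function.update π v o) = Φ π) :
    prodMean p Φ = prodMean p' Φ := by
  induction B using Finset.induction_on generalizing p with
  | empty => rw [funext fun v => h v (by simp)]
  | insert v B hv ih =>
    rw [prodMean_update (hp v) (hp' v) (hΦ v (by simp))]
    refine ih ?_ ?_ fun u hu => hΦ u (by simp [hu])
    · intro u
      by_cases huv : u = v
      · subst huv; simpa using hp' u
      · simpa [huv] using hp u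
    · intro u hu
      by_cases huv : u = v
      · subst huv; simp
      · rw [Function.update_of_ne huv]
        exact h u (by simp [huv, hu])

/-- Replace the values on `B` by `none`. -/
def clearOn (B : Finset V) (π : V → Option V) : V → Option V := fun v => if v ∈ B then none else π v

lemma HamLip.abs_clearOn_sub_le {ℓ : ℝ} {y : (V → Option V) → ℝ} (hy : HamLip ℓ y) (B : Finset V)
    (π : V → Option V) : |y (clearOn B π) - y π| ≤ ℓ * B.card := by
  induction B using Finset.induction_on with
  | empty =>
    have : clearOn ∅ π = π := by ext1 u; simp [clearOn]
    simp [this]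
  | insert v B hv ih =>
    have h1 : clearOn (insert v B) π = Function.update (clearOn B π) v none := by
      ext1 u
      by_cases huv : u = v
      · subst huv; simp [clearOn]
      · simp [clearOn, huv]
    rw [h1, Finset.card_insert_of_notMem hv]
    have h2 := hy (clearOn B π) v none
    have h3 := abs_sub_le (y (Function.update (clearOn B π) v none)) (y (clearOn B π)) (y π)
    push_cast
    linarith

lemma HamLip.abs_sub_le {ℓ : ℝ} {y : (V → Option V) → ℝ} (hy : HamLip ℓ y)
    (π π' : V → Option V) : |y π - y π'| ≤ 2 * ℓ * Fintype.card V := by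
  have h1 := hy.abs_clearOn_sub_le univ π
  have h2 := hy.abs_clearOn_sub_le univ π'
  have h3 : clearOn univ π = clearOn univ π' := by ext1 u; simp [clearOn]
  rw [h3] at h1
  rw [Finset.card_univ] at h1 h2
  rw [abs_le] at *
  constructor <;> linarith

/-- No two vertices outside `B` are mapped to each other. -/
def NoTwoCycle (B : Finset V) (π : V → Option V) : Prop :=
  ∀ v ∉ B, ∀ u ∉ B, π v = some u → π u ≠ some v

lemma Acyc.noTwoCycle {π : V → Option V} (h : Acyc π) (B : Finset V) : NoTwoCycle B π := by
  obtain ⟨rk, hrk⟩ := h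
  intro v _ u _ h1 h2
  have := hrk _ _ h1
  have := hrk _ _ h2
  omega

open scoped Classical in
/-- The exponential sum over maps without two-cycles off `B`, with modified weights off `B`. -/
def offSum (p g : V → Option V → ℝ) (y : (V → Option V) → ℝ) (B : Finset V) : ℝ :=
  ∑ π : V → Option V, if NoTwoCycle B π then
    (∏ v, p v (π v)) * (∏ v ∈ univ \ B, g v (π v)) * Real.exp (y π) else 0

lemma offSum_nonneg {p g : V → Option V → ℝ} (hp : ∀ v o, 0 ≤ p v o) (hg : ∀ v o, 0 ≤ g v o)
    (y : (V → Option V) → ℝ) (B : Finset V) : 0 ≤ offSum p g y B := by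
  refine Finset.sum_nonneg fun π _ => ?_
  split_ifs
  · exact mul_nonneg (mul_nonneg (Finset.prod_nonneg fun _ _ => hp _ _)
      (Finset.prod_nonneg fun _ _ => hg _ _)) (Real.exp_pos _).le
  · rfl

open scoped Classical in
lemma prodMean_acyc_exp_le {p p₁ g : V → Option V → ℝ} (hp0 : ∀ v o, 0 ≤ p v o)
    (hp : ∀ v, ∑ o, p v o = 1) (hp₁0 : ∀ v o, 0 ≤ p₁ v o) (hp₁ : ∀ v, ∑ o, p₁ v o = 1)
    (B : Finset V) {R : ℝ} (hR : 1 ≤ R)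
    (hle : ∀ v ∉ B, ∀ o, p v o ≤ R * (p₁ v o * g v o)) {ℓ : ℝ} {y : (V → Option V) → ℝ}
    (hy : HamLip ℓ y) :
    prodMean p (fun π => if Acyc π then Real.exp (y π) else 0) ≤
      Real.exp (2 * ℓ * B.card) * R ^ Fintype.card V * offSum p₁ g y B := by
  set Ψ : (V → Option V) → ℝ := fun π =>
    if NoTwoCycle B π then Real.exp (y (clearOn B π)) else 0 with hΨ
  have hΨinv : ∀ v ∈ B, ∀ π o, Ψ (Function.update π v o) = Ψ π := by
    intro v hv π o
    have h1 : clearOn B (Function.update π v o) = clearOn B π := by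
      ext1 u
      by_cases hu : u ∈ B
      · simp [clearOn, hu]
      · have : u ≠ v := fun h => hu (h ▸ hv)
        simp [clearOn, this]
    have h2 : NoTwoCycle B (Function.update π v o) ↔ NoTwoCycle B π := by
      refine forall₂_congr fun u hu => forall₂_congr fun u' hu' => ?_
      have h3 : u ≠ v := fun h => hu (h ▸ hv)
      have h4 : u' ≠ v := fun h => hu' (h ▸ hv)
      rw [Function.update_of_ne h3, Function.update_of_ne h4]
    simp only [hΨ, h1, h2]
  set p' : V → Option V → ℝ := fun v => if v ∈ B then p₁ v else p v with hp'def
  have hp' : ∀ v, ∑ o, p' v o = 1 := by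
    intro v
    by_cases hv : v ∈ B <;> simp [hp'def, hv, hp, hp₁]
  have hp'0 : ∀ v o, 0 ≤ p' v o := by
    intro v o
    by_cases hv : v ∈ B <;> simp [hp'def, hv, hp0, hp₁0]
  have h1 : prodMean p (fun π => if Acyc π then Real.exp (y π) else 0) ≤
      Real.exp (ℓ * B.card) * prodMean p Ψ := by
    rw [← prodMean_const_mul]
    refine prodMean_mono hp0 fun π => ?_
    by_cases hA : Acyc π
    · simp only [hΨ, hA, hA.noTwoCycle B, if_true]
      rw [← Real.exp_add]
      have := (abs_le.1 (hy.abs_clearOn_sub_le B π)).1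
      exact Real.exp_le_exp.2 (by linarith)
    · simp only [hA, if_false, hΨ]
      split_ifs <;> positivity
  have h2 : prodMean p Ψ = prodMean p' Ψ :=
    prodMean_congr_off B hp hp' (fun v hv => by simp [hp'def, hv]) hΨinv
  have h3 : prodMean p' Ψ ≤ Real.exp (ℓ * B.card) * (R ^ Fintype.card V * offSum p₁ g y B) := by
    unfold prodMean offSum
    simp only [Finset.mul_sum]
    refine Finset.sum_le_sum fun π _ => ?_
    by_cases hN : NoTwoCycle B π
    · simp only [hΨ, hN, if_true]
      have h4 : Real.exp (y (clearOn B π)) ≤ Real.exp (ℓ * B.card) * Real.exp (y π) := by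
        rw [← Real.exp_add]
        have := (abs_le.1 (hy.abs_clearOn_sub_le B π)).2
        exact Real.exp_le_exp.2 (by linarith)
      have h5 : ∏ v, p' v (π v) ≤
          R ^ Fintype.card V * ((∏ v, p₁ v (π v)) * ∏ v ∈ univ \ B, g v (π v)) := by
        have h6 : ∏ v ∈ univ \ B, g v (π v) = ∏ v, if v ∈ B then 1 else g v (π v) := by
          rw [← Finset.prod_sdiff (Finset.subset_univ B)]
          have e1 : ∏ v ∈ B, (if v ∈ B then (1:ℝ) else g v (π v)) = 1 :=
            Finset.prod_eq_one fun v hv => by simp [hv]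
          rw [e1, mul_one]
          exact Finset.prod_congr rfl fun v hv => by simp [(Finset.mem_sdiff.1 hv).2]
        rw [h6, ← Finset.prod_mul_distrib, ← Finset.card_univ, ← Finset.prod_const,
          ← Finset.prod_mul_distrib]
        refine Finset.prod_le_prod (fun v _ => hp'0 _ _) fun v _ => ?_
        by_cases hv : v ∈ B
        · simp only [hp'def, hv, if_true, mul_one]
          exact le_mul_of_one_le_left (hp₁0 _ _) hR
        · simp only [hp'def, hv, if_false]
          exact hle v hv _
      calc _ ≤ (R ^ Fintype.card V * ((∏ v, p₁ v (π v)) * ∏ v ∈ univ \ B, g v (π v))) *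
            (Real.exp (ℓ * B.card) * Real.exp (y π)) :=
            mul_le_mul h5 h4 (Real.exp_pos _).le ((Finset.prod_nonneg fun v _ => hp'0 _ _).trans h5)
        _ = _ := by ring
    · simp [hΨ, hN]
  calc _ ≤ Real.exp (ℓ * B.card) * prodMean p Ψ := h1
    _ ≤ Real.exp (ℓ * B.card) *
        (Real.exp (ℓ * B.card) * (R ^ Fintype.card V * offSum p₁ g y B)) := by
        rw [h2]; exact mul_le_mul_of_nonneg_left h3 (Real.exp_pos _).le
    _ = _ := by
        have : 2 * ℓ * (B.card : ℝ) = ℓ * B.card + ℓ * B.card := by ring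
        rw [this, Real.exp_add]; ring

/-- A sum controlling the cycles of independent choices. -/
lemma sum_sq_div_le {a : V → V → ℝ} (ha : ∀ v u, 0 ≤ a v u) (ha1 : ∀ v u, a v u ≤ 1)
    (hs : ∀ v u, a v u = a u v)
    {C : V → ℝ} (hC : ∀ v, C v = ∑ u, a v u) (hC0 : ∀ v, 0 < C v) (B : Finset V) {M : ℝ}
    (hM : 0 < M) (hB : ∀ v ∉ B, M ≤ C v) :
    ∑ v, ∑ u, a v u ^ 2 / (C v * C u) ≤ Fintype.card V / M + B.card := by
  have haC : ∀ v u, a v u ≤ C v := fun v u => by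
    rw [hC]; exact Finset.single_le_sum (fun u _ => ha v u) (mem_univ u)
  have h1 : ∀ v u, a v u ^ 2 / (C v * C u) ≤
      a v u / (C v * M) + if u ∈ B then a v u / C u else 0 := by
    intro v u
    have := hC0 v
    have := hC0 u
    have := ha v u
    by_cases hu : u ∈ B
    · simp only [hu, if_true]
      have h2 : a v u ^ 2 / (C v * C u) ≤ a v u / C u := by
        rw [div_le_div_iff₀ (by positivity) (by positivity)]
        nlinarith [mul_le_mul_of_nonneg_left (haC v u) (mul_nonneg (ha v u) (hC0 u).le)]
      have : 0 ≤ a v u / (C v * M) := by positivity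
      linarith
    · simp only [hu, if_false, add_zero]
      have h3 := hB u hu
      calc a v u ^ 2 / (C v * C u) ≤ a v u / (C v * C u) := by
            gcongr
            nlinarith [ha1 v u]
        _ ≤ _ := by gcongr
  calc _ ≤ ∑ v, ∑ u, (a v u / (C v * M) + if u ∈ B then a v u / C u else 0) :=
        Finset.sum_le_sum fun v _ => Finset.sum_le_sum fun u _ => h1 v u
    _ = (∑ v, ∑ u, a v u / (C v * M)) + ∑ u, ∑ v, if u ∈ B then a v u / C u else 0 := by
        simp only [Finset.sum_add_distrib]
        congr 1
        exact Finset.sum_comm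
    _ = _ := by
        congr 1
        · have : ∀ v, ∑ u, a v u / (C v * M) = 1 / M := fun v => by
            rw [← Finset.sum_div, ← hC]
            have := (hC0 v).ne'
            field_simp
          rw [Finset.sum_congr rfl fun v _ => this v, Finset.sum_const, Finset.card_univ,
            nsmul_eq_mul, mul_one_div]
        · have : ∀ u, ∑ v, (if u ∈ B then a v u / C u else 0) = if u ∈ B then 1 else 0 := fun u => by
            split_ifs
            · rw [← Finset.sum_div]
              simp only [hs _ u]
              rw [← hC, div_self (hC0 u).ne']
            · simp
          simp [this]

/-- Total conductance at a vertex. -/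
def wdeg (G : SimpleGraph V) (c : Sym2 V → ℝ) (v : V) : ℝ := ∑ u, edgeW G c s(v, u)

/-- The weights of the killed forest measure with killing proportional to the conductance. -/
def killW (G : SimpleGraph V) (c : Sym2 V → ℝ) (κ : ℝ) : Sym2 (Option V) → ℝ :=
  extW (edgeW G c) fun v => κ * wdeg G c v

/-- One step of the killed simple random walk. -/
def srwStep (G : SimpleGraph V) [DecidableRel G.Adj] (κ : ℝ) (v : V) (o : Option V) : ℝ :=
  o.elim (κ / (1 + κ)) fun u => if G.Adj v u then (1 + κ)⁻¹ / G.degree v else 0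

/-- Normalized conductances. -/
def normW (c : Sym2 V → ℝ) (m : ℝ) (v : V) (o : Option V) : ℝ := o.elim 1 fun u => c s(v, u) / m

lemma wdeg_eq (G : SimpleGraph V) [DecidableRel G.Adj] (c : Sym2 V → ℝ) (v : V) :
    wdeg G c v = ∑ u ∈ G.neighborFinset v, c s(v, u) := by
  unfold wdeg edgeW
  rw [G.neighborFinset_eq_filter, Finset.sum_filter]
  refine Finset.sum_congr rfl fun u _ => ?_
  simp only [SimpleGraph.mem_edgeSet]

lemma wdeg_pos {G : SimpleGraph V} [DecidableRel G.Adj] {c : Sym2 V → ℝ} (hc : ∀ e, 0 < c e) {v : V}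
    (hv : 0 < G.degree v) : 0 < wdeg G c v := by
  rw [wdeg_eq]
  refine Finset.sum_pos (fun _ _ => hc _) ?_
  rw [← Finset.card_pos]
  exact hv

lemma srwStep_nonneg (G : SimpleGraph V) [DecidableRel G.Adj] {κ : ℝ} (hκ : 0 < κ) (v : V)
    (o : Option V) : 0 ≤ srwStep G κ v o := by
  rcases o with _ | u
  · simp only [srwStep, Option.elim]; positivity
  · simp only [srwStep, Option.elim]; split_ifs <;> positivity

lemma sum_srwStep (G : SimpleGraph V) [DecidableRel G.Adj] {κ : ℝ} (hκ : 0 < κ) {v : V}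
    (hv : 0 < G.degree v) : ∑ o, srwStep G κ v o = 1 := by
  rw [Fintype.sum_option]
  simp only [srwStep, Option.elim]
  rw [← Finset.sum_filter, Finset.sum_const, ← G.neighborFinset_eq_filter, G.card_neighborFinset_eq_degree]
  have : (0:ℝ) < G.degree v := by exact_mod_cast hv
  rw [nsmul_eq_mul]
  field_simp
  ring

open scoped Classical in
lemma forestMean_killW_le {G : SimpleGraph V} [DecidableRel G.Adj] {c : Sym2 V → ℝ}
    (hc : ∀ e, 0 < c e) (hdeg : ∀ v, 0 < G.degree v) {κ : ℝ} (hκ : 0 < κ)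
    {Φ : (V → Option V) → ℝ} (hΦ : ∀ π, 0 ≤ Φ π) :
    forestMean (killW G c κ) Φ ≤
      Real.exp ((1 + κ) / κ *
        ∑ v, ∑ u, edgeW G c s(v, u) ^ 2 / (wdeg G c v * wdeg G c u)) *
      prodMean (fun v o => killW G c κ s(some v, o) / ((1 + κ) * wdeg G c v))
        (fun π => if Acyc π then Φ π else 0) := by
  have hw := fun v => wdeg_pos hc (hdeg v)
  have hP : 0 < ∏ v, ((1 + κ) * wdeg G c v) :=
    Finset.prod_pos fun v _ => mul_pos (by linarith) (hw v)
  have hnn : ∀ e, 0 ≤ killW G c κ e :=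
    extW_nonneg (edgeW_nonneg G hc) fun v => (mul_pos hκ (hw v)).le
  have hden := det_killedLap_ge (a := fun v u => edgeW G c s(v, u)) (C := wdeg G c)
    (fun v u => edgeW_nonneg G hc _) (fun v u => by rw [Sym2.eq_swap])
    (fun v => by simp [edgeW]) (fun v => rfl) hw hκ
  have hW : (killedLap fun v o => Option.elim o (κ * wdeg G c v) fun u => edgeW G c s(v, u)) =
      symLap (killW G c κ) := by
    unfold symLap
    congr 1
    ext v o
    rcases o with _ | u <;> simp [killW]
  rw [hW, det_symLap] at hden
  have hnum : ∑ π : Forest V, forestWeight (killW G c κ) π * Φ π.1 =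
      (∏ v, ((1 + κ) * wdeg G c v)) *
      prodMean (fun v o => killW G c κ s(some v, o) / ((1 + κ) * wdeg G c v))
        (fun π => if Acyc π then Φ π else 0) := by
    unfold prodMean
    rw [Finset.mul_sum]
    have h1 : ∀ π : V → Option V, (∏ v, ((1 + κ) * wdeg G c v)) *
        ((∏ v, killW G c κ s(some v, π v) / ((1 + κ) * wdeg G c v)) *
          (if Acyc π then Φ π else 0)) =
        if Acyc π then (∏ v, killW G c κ s(some v, π v)) * Φ π else 0 := by
      intro π
      rw [Finset.prod_div_distrib]
      split_ifs
      · field_simp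
      · simp
    rw [Finset.sum_congr rfl fun π _ => h1 π, ← Finset.sum_filter,
      Finset.sum_subtype (p := Acyc) _ (by simp)]
    exact Finset.sum_congr rfl fun π _ => by rw [forestWeight, prod_forestEdges π.2]
  have hpm : 0 ≤ prodMean (fun v o => killW G c κ s(some v, o) / ((1 + κ) * wdeg G c v))
        (fun π => if Acyc π then Φ π else 0) := by
    refine Finset.sum_nonneg fun π _ => mul_nonneg (Finset.prod_nonneg fun v _ =>
      div_nonneg (hnn _) (mul_pos (by linarith) (hw v)).le) ?_
    beta_reduce
    split_ifs
    · exact hΦ π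
    · rfl
  unfold forestMean
  rw [hnum]
  set S := (1 + κ) / κ * ∑ v, ∑ u, edgeW G c s(v, u) ^ 2 / (wdeg G c v * wdeg G c u)
  have hpos : 0 < ∑ π : Forest V, forestWeight (killW G c κ) π :=
    lt_of_lt_of_le (mul_pos hP (Real.exp_pos _)) hden
  rw [div_le_iff₀ hpos]
  have hden' : (∏ v, ((1 + κ) * wdeg G c v)) ≤
      Real.exp S * ∑ π : Forest V, forestWeight (killW G c κ) π := by
    have h2 := mul_le_mul_of_nonneg_left hden (Real.exp_pos S).le
    rw [mul_left_comm, ← Real.exp_add] at h2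
    simpa [forestWeight] using h2
  calc _ ≤ (Real.exp S * ∑ π : Forest V, forestWeight (killW G c κ) π) * _ :=
        mul_le_mul_of_nonneg_right hden' hpm
    _ = _ := by ring

/-- Exponential moments under the killed forest measure. -/
lemma forestMean_exp_le {G : SimpleGraph V} [DecidableRel G.Adj] {c : Sym2 V → ℝ}
    (hc : ∀ e, 0 < c e) (hc1 : ∀ e, c e ≤ 1) (hdeg : ∀ v, 0 < G.degree v) {κ : ℝ} (hκ : 0 < κ)
    (B : Finset V) {M m ε : ℝ} (hM : 0 < M) (hm : 0 < m) (hε0 : 0 ≤ ε) (hε : ε < 1)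
    (hBM : ∀ v ∉ B, M ≤ wdeg G c v) (hBd : ∀ v ∉ B, (1 - ε) * (G.degree v * m) ≤ wdeg G c v)
    {ℓ : ℝ} {y : (V → Option V) → ℝ} (hy : HamLip ℓ y) :
    forestMean (killW G c κ) (fun π => Real.exp (y π)) ≤
      Real.exp ((1 + κ) / κ * (Fintype.card V / M + B.card)) *
      (Real.exp (2 * ℓ * B.card) * ((1 - ε)⁻¹) ^ Fintype.card V *
        offSum (srwStep G κ) (normW c m) y B) := by
  classical
  have hw := fun v => wdeg_pos hc (hdeg v)
  have hnn : ∀ e, 0 ≤ killW G c κ e :=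
    extW_nonneg (edgeW_nonneg G hc) fun v => (mul_pos hκ (hw v)).le
  have hR : 1 ≤ (1 - ε)⁻¹ := (one_le_inv₀ (by linarith)).2 (by linarith)
  refine (forestMean_killW_le hc hdeg hκ fun π => (Real.exp_pos _).le).trans ?_
  refine mul_le_mul (Real.exp_le_exp.2 (mul_le_mul_of_nonneg_left ?_ (by positivity))) ?_ ?_
    (Real.exp_pos _).le
  · refine sum_sq_div_le (fun v u => edgeW_nonneg G hc _) (fun v u => ?_)
      (fun v u => by rw [Sym2.eq_swap]) (fun v => rfl) hw B hM hBM
    unfold edgeW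
    split_ifs
    · exact hc1 _
    · exact zero_le_one
  · refine prodMean_acyc_exp_le (fun v o => div_nonneg (hnn _) (mul_pos (by linarith) (hw v)).le)
      (fun v => ?_) (srwStep_nonneg G hκ) (fun v => sum_srwStep G hκ (hdeg v)) B hR
      (fun v hv o => ?_) hy
    · rw [← Finset.sum_div, Fintype.sum_option]
      simp only [killW, extW_none, extW_some]
      have := hw v
      rw [div_eq_one_iff_eq (by positivity)]
      change κ * wdeg G c v + wdeg G c v = _
      ring
    · have h1 := hw v
      have h2 : (0:ℝ) < G.degree v := by exact_mod_cast hdeg v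
      have h3 : 0 < 1 - ε := by linarith
      rcases o with _ | u
      · simp only [killW, extW_none, srwStep, normW, Option.elim, mul_one]
        have : κ * wdeg G c v / ((1 + κ) * wdeg G c v) = κ / (1 + κ) := by field_simp
        rw [this]
        exact le_mul_of_one_le_left (by positivity) hR
      · simp only [killW, extW_some, srwStep, normW, Option.elim, edgeW, SimpleGraph.mem_edgeSet]
        split_ifs with h
        · have h4 := hBd v hv
          have h5 := (hc s(v, u)).le
          calc c s(v, u) / ((1 + κ) * wdeg G c v) ≤
                c s(v, u) / ((1 + κ) * ((1 - ε) * (G.degree v * m))) := by gcongr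
            _ = _ := by field_simp
        · simp
  · refine Finset.sum_nonneg fun π _ => mul_nonneg (Finset.prod_nonneg fun v _ =>
      div_nonneg (hnn _) (mul_pos (by linarith) (hw v)).le) ?_
    beta_reduce
    split_ifs <;> positivity

instance : IsProbabilityMeasure (volume.restrict (Set.Icc (0:ℝ) 1)) := ⟨by simp⟩

instance (ι : Type) [Fintype ι] : IsProbabilityMeasure (labelMeasure ι) := by
  unfold labelMeasure; infer_instance

section Labels

variable {ι : Type} [Fintype ι] [DecidableEq ι]

lemma labelMeasure_eq_restrict :
    labelMeasure ι = volume.restrict (Set.univ.pi fun _ : ι => Set.Icc (0:ℝ) 1) := by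
  rw [labelMeasure, volume_pi, Measure.restrict_pi_pi]

lemma isCompact_cube : IsCompact (Set.univ.pi fun _ : ι => Set.Icc (0:ℝ) 1) :=
  isCompact_univ_pi fun _ => isCompact_Icc

lemma integrable_labelMeasure {F : (ι → ℝ) → ℝ} (hF : Continuous F) :
    Integrable F (labelMeasure ι) := by
  rw [labelMeasure_eq_restrict]
  exact hF.continuousOn.integrableOn_compact isCompact_cube

lemma ae_labelMeasure : ∀ᵐ u ∂(labelMeasure ι), ∀ e, u e ∈ Set.Icc (0:ℝ) 1 := by
  rw [labelMeasure_eq_restrict]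
  filter_upwards [ae_restrict_mem (MeasurableSet.univ_pi fun _ => measurableSet_Icc)] with u hu e
  exact hu e (Set.mem_univ e)

lemma integral_prod_labels (S : Finset ι) (f : ℝ → ℝ) :
    ∫ u, ∏ e ∈ S, f (u e) ∂(labelMeasure ι) = (∫ x in Set.Icc (0:ℝ) 1, f x) ^ S.card := by
  have h1 : ∀ u : ι → ℝ, ∏ e ∈ S, f (u e) = ∏ e, (if e ∈ S then f else fun _ => 1) (u e) := by
    intro u
    rw [← Finset.prod_sdiff (Finset.subset_univ S)]
    have h2 : ∏ e ∈ univ \ S, (if e ∈ S then f else fun _ => 1) (u e) = 1 :=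
      Finset.prod_eq_one fun e he => by simp [(Finset.mem_sdiff.1 he).2]
    rw [h2, one_mul]
    exact Finset.prod_congr rfl fun e he => by simp [he]
  simp only [h1]
  rw [labelMeasure, integral_fintype_prod_eq_prod, ← Finset.prod_sdiff (Finset.subset_univ S)]
  have h2 : ∏ e ∈ univ \ S, (∫ x in Set.Icc (0:ℝ) 1, (if e ∈ S then f else fun _ => 1) x) = 1 :=
    Finset.prod_eq_one fun e he => by simp [(Finset.mem_sdiff.1 he).2]
  rw [h2, one_mul, ← Finset.prod_const]
  exact Finset.prod_congr rfl fun e he => by simp [he]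

/-- Mean conductance. -/
def meanW (β : ℝ) : ℝ := ∫ x in Set.Icc (0:ℝ) 1, Real.exp (-β * x)

lemma integrableOn_Icc {f : ℝ → ℝ} (hf : Continuous f) : IntegrableOn f (Set.Icc (0:ℝ) 1) :=
  hf.continuousOn.integrableOn_compact isCompact_Icc

lemma meanW_ge {β : ℝ} (hβ : 0 ≤ β) : 1 / (1 + β) ≤ meanW β := by
  unfold meanW
  rcases hβ.eq_or_lt with rfl | hβ'
  · simp
  rw [integral_Icc_eq_integral_Ioc, ← intervalIntegral.integral_of_le zero_le_one]
  have h1 : ∀ x, HasDerivAt (fun x => -(Real.exp (-β * x)) / β) (Real.exp (-β * x)) x := by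
    intro x
    have h2 := (((hasDerivAt_id' x).const_mul (-β)).exp.neg).div_const β
    have h3 : -(Real.exp (-β * x) * (-β * 1)) / β = Real.exp (-β * x) := by field_simp
    rwa [h3] at h2
  rw [intervalIntegral.integral_eq_sub_of_hasDerivAt (fun x _ => h1 x)
    (Continuous.intervalIntegrable (by fun_prop) _ _)]
  have h2 : Real.exp (-β * 1) ≤ 1 / (1 + β) := by
    rw [mul_one, Real.exp_neg, ← one_div]
    exact one_div_le_one_div_of_le (by linarith) (by linarith [Real.add_one_le_exp β])
  have h3 : 1 / (1 + β) = (1 - 1 / (1 + β)) / β := by field_simp; ring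
  rw [h3]
  have h4 : -Real.exp (-β * 1) / β - -Real.exp (-β * 0) / β = (1 - Real.exp (-β * 1)) / β := by
    simp; ring
  rw [h4]
  gcongr

lemma meanW_pos {β : ℝ} (hβ : 0 ≤ β) : 0 < meanW β :=
  lt_of_lt_of_le (by positivity) (meanW_ge hβ)

lemma integral_centered (β : ℝ) : ∫ x in Set.Icc (0:ℝ) 1, (Real.exp (-β * x) - meanW β) = 0 := by
  rw [integral_sub (integrableOn_Icc (by fun_prop)) (integrable_const _)]
  simp [meanW]

lemma integral_centered_sq_le {β : ℝ} (hβ : 0 ≤ β) :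
    ∫ x in Set.Icc (0:ℝ) 1, (Real.exp (-β * x) - meanW β) ^ 2 ≤ meanW β := by
  have h1 : ∫ x in Set.Icc (0:ℝ) 1, (Real.exp (-β * x) - meanW β) ^ 2 ≤
      ∫ x in Set.Icc (0:ℝ) 1,
        (Real.exp (-β * x) - 2 * meanW β * (Real.exp (-β * x) - meanW β) - meanW β ^ 2) := by
    refine setIntegral_mono_on (integrableOn_Icc (by fun_prop)) (integrableOn_Icc (by fun_prop))
      measurableSet_Icc fun x hx => ?_
    have h2 : Real.exp (-β * x) ≤ 1 := Real.exp_le_one_iff.2 (by nlinarith [hx.1])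
    nlinarith [Real.exp_pos (-β * x)]
  refine h1.trans ?_
  rw [integral_sub (integrableOn_Icc (by fun_prop)) (integrable_const _),
    integral_sub (integrableOn_Icc (by fun_prop)) (integrableOn_Icc (by fun_prop)),
    integral_const_mul, integral_centered]
  have : ∫ x in Set.Icc (0:ℝ) 1, Real.exp (-β * x) = meanW β := rfl
  rw [this]
  simp
  positivity

lemma integral_sum_centered_sq_le {β : ℝ} (hβ : 0 ≤ β) (S : Finset ι) :
    ∫ u, (∑ e ∈ S, (Real.exp (-β * u e) - meanW β)) ^ 2 ∂(labelMeasure ι) ≤ S.card * meanW β := by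
  simp only [pow_two, Finset.sum_mul_sum]
  rw [integral_finsetSum _ fun e _ => integrable_labelMeasure (by fun_prop)]
  have h1 : ∀ e ∈ S, ∫ u, ∑ f ∈ S, (Real.exp (-β * u e) - meanW β) *
      (Real.exp (-β * u f) - meanW β) ∂(labelMeasure ι) ≤ meanW β := by
    intro e he
    rw [integral_finsetSum _ fun e _ => integrable_labelMeasure (by fun_prop),
      Finset.sum_eq_single_of_mem e he]
    · have h2 := integral_prod_labels {e} (fun x => (Real.exp (-β * x) - meanW β) ^ 2)
      simp only [Finset.prod_singleton, Finset.card_singleton, pow_one] at h2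
      simp only [← pow_two]
      rw [h2]
      exact integral_centered_sq_le hβ
    · intro f _ hf
      have h2 := integral_prod_labels {e, f} (fun x => Real.exp (-β * x) - meanW β)
      simp only [Finset.prod_pair hf.symm] at h2
      rw [h2, integral_centered, Finset.card_pair hf.symm]
      simp
  refine (Finset.sum_le_sum h1).trans ?_
  simp

end Labels

/-- Random conductances. -/
def expW (β : ℝ) (u : Sym2 V → ℝ) (e : Sym2 V) : ℝ := Real.exp (-β * u e)

lemma continuous_expW (β : ℝ) (e : Sym2 V) : Continuous fun u : Sym2 V → ℝ => expW β u e := by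
  unfold expW; fun_prop

lemma continuous_edgeW (G : SimpleGraph V) (β : ℝ) (e : Sym2 V) :
    Continuous fun u : Sym2 V → ℝ => edgeW G (expW β u) e := by
  unfold edgeW
  split_ifs
  · exact continuous_expW β e
  · exact continuous_const

lemma continuous_wdeg (G : SimpleGraph V) (β : ℝ) (v : V) :
    Continuous fun u : Sym2 V → ℝ => wdeg G (expW β u) v :=
  continuous_finsetSum _ fun _ _ => continuous_edgeW G β _

lemma continuous_killW (G : SimpleGraph V) (β κ : ℝ) (e : Sym2 (Option V)) :
    Continuous fun u : Sym2 V → ℝ => killW G (expW β u) κ e := by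
  induction e using Sym2.inductionOn with | _ o o' =>
  rcases o with _ | v <;> rcases o' with _ | v'
  · exact continuous_const
  · exact (continuous_wdeg G β v').const_mul κ |>.congr fun u => rfl
  · exact (continuous_wdeg G β v).const_mul κ |>.congr fun u => rfl
  · exact continuous_edgeW G β s(v, v')

lemma continuous_forestMean {G : SimpleGraph V} [DecidableRel G.Adj] (hdeg : ∀ v, 0 < G.degree v)
    (β : ℝ) {κ : ℝ} (hκ : 0 < κ) (h : (V → Option V) → ℝ) :
    Continuous fun u : Sym2 V → ℝ => forestMean (killW G (expW β u) κ) h := by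
  unfold forestMean forestWeight
  refine Continuous.div ?_ ?_ fun u => ?_
  · exact continuous_finsetSum _ fun _ _ =>
      (continuous_finsetProd _ fun _ _ => continuous_killW G β κ _).mul continuous_const
  · exact continuous_finsetSum _ fun _ _ => continuous_finsetProd _ fun _ _ => continuous_killW G β κ _
  · have hc : ∀ e, 0 < expW β u e := fun e => Real.exp_pos _
    exact (sum_forestWeight_pos (edgeW_nonneg G hc) fun v => mul_pos hκ (wdeg_pos hc (hdeg v))).ne'

lemma continuous_treeMean {G : SimpleGraph V} (hG : G.Connected) (β : ℝ)
    (f : Finset (Sym2 V) → ℝ) :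
    Continuous fun u : Sym2 V → ℝ => treeMean G (expW β u) f := by
  unfold treeMean treeWeight
  refine Continuous.div ?_ ?_ fun u => ?_
  · exact continuous_finsetSum _ fun _ _ =>
      (continuous_finsetProd _ fun _ _ => continuous_expW β _).mul continuous_const
  · exact continuous_finsetSum _ fun _ _ => continuous_finsetProd _ fun _ _ => continuous_expW β _
  · exact (partZ_pos hG fun e => Real.exp_pos _).ne'

lemma continuous_normW (β m : ℝ) (v : V) (o : Option V) :
    Continuous fun u : Sym2 V → ℝ => normW (expW β u) m v o := by
  rcases o with _ | v'
  · exact continuous_const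
  · exact (continuous_expW β _).div_const m

open scoped Classical in
lemma continuous_offSum (p : V → Option V → ℝ) (β m : ℝ) (y : (V → Option V) → ℝ) (B : Finset V) :
    Continuous fun u : Sym2 V → ℝ => offSum p (normW (expW β u) m) y B := by
  unfold offSum
  refine continuous_finsetSum _ fun π _ => ?_
  split_ifs
  · exact (continuous_const.mul (continuous_finsetProd _ fun _ _ => continuous_normW β m _ _)).mul
      continuous_const
  · exact continuous_const

lemma integral_prod_normW {β : ℝ} (hβ : 0 ≤ β) {B : Finset V} {π : V → Option V}
    (h : NoTwoCycle B π) :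
    ∫ u, ∏ v ∈ univ \ B, normW (expW β u) (meanW β) v (π v) ∂(labelMeasure (Sym2 V)) = 1 := by
  set A := (univ \ B).filter fun v => π v ≠ none with hA
  have hinj : Set.InjOn (fun v => s(v, (π v).getD v)) (A : Set V) := by
    intro v hv u hu hvu
    simp only [hA, coe_filter, Finset.mem_sdiff, mem_univ, true_and, Set.mem_ofPred_eq] at hv hu
    obtain ⟨v', hv'⟩ := Option.ne_none_iff_exists'.1 hv.2
    obtain ⟨u', hu'⟩ := Option.ne_none_iff_exists'.1 hu.2
    simp only [hv', hu', Option.getD_some, Sym2.eq_iff] at hvu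
    rcases hvu with ⟨h1, _⟩ | ⟨h1, h2⟩
    · exact h1
    · subst h1 h2
      exact absurd hu' (h _ hv.1 _ hu.1 hv')
  have h1 : ∀ u : Sym2 V → ℝ, ∏ v ∈ univ \ B, normW (expW β u) (meanW β) v (π v) =
      ∏ e ∈ A.image fun v => s(v, (π v).getD v), Real.exp (-β * u e) / meanW β := by
    intro u
    rw [Finset.prod_image hinj, hA, Finset.prod_filter]
    refine Finset.prod_congr rfl fun v _ => ?_
    rcases hv : π v with _ | v'
    · simp [normW]
    · simp [normW, expW]
  simp only [h1]
  rw [integral_prod_labels _ fun x => Real.exp (-β * x) / meanW β, integral_div]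
  change (meanW β / meanW β) ^ _ = 1
  rw [div_self (meanW_pos hβ).ne', one_pow]

open scoped Classical in
lemma integral_offSum_le {p : V → Option V → ℝ} (hp : ∀ v o, 0 ≤ p v o) {β : ℝ} (hβ : 0 ≤ β)
    (y : (V → Option V) → ℝ) (B : Finset V) :
    ∫ u, offSum p (normW (expW β u) (meanW β)) y B ∂(labelMeasure (Sym2 V)) ≤
      prodMean p fun π => Real.exp (y π) := by
  unfold offSum prodMean
  have hcont : ∀ π : V → Option V, Continuous fun u : Sym2 V → ℝ =>
      ∏ v ∈ univ \ B, normW (expW β u) (meanW β) v (π v) := fun π =>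
    continuous_finsetProd _ fun _ _ => continuous_normW β _ _ _
  rw [integral_finsetSum]
  · refine Finset.sum_le_sum fun π _ => ?_
    by_cases hN : NoTwoCycle B π
    · simp only [hN, if_true]
      rw [integral_mul_const, integral_const_mul, integral_prod_normW hβ hN, mul_one]
    · simp only [hN, if_false, integral_zero]
      exact mul_nonneg (Finset.prod_nonneg fun _ _ => hp _ _) (Real.exp_pos _).le
  · intro π _
    refine integrable_labelMeasure ?_
    split_ifs
    · exact (continuous_const.mul (hcont π)).mul continuous_const
    · exact continuous_const

lemma integral_wdeg_sq_le (G : SimpleGraph V) [DecidableRel G.Adj] {β : ℝ} (hβ : 0 ≤ β) (v : V) :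
    ∫ u, (wdeg G (expW β u) v - G.degree v * meanW β) ^ 2 ∂(labelMeasure (Sym2 V)) ≤
      G.degree v * meanW β := by
  have hinj : Set.InjOn (fun u => s(v, u)) (G.neighborFinset v : Set V) := by
    intro a _ b _ hab
    exact Sym2.congr_right.1 hab
  have h1 := integral_sum_centered_sq_le hβ ((G.neighborFinset v).image fun u => s(v, u))
  rw [Finset.card_image_of_injOn hinj, G.card_neighborFinset_eq_degree] at h1
  refine le_of_eq_of_le ?_ h1
  congr 1
  ext u
  rw [Finset.sum_image hinj, Finset.sum_sub_distrib, wdeg_eq, Finset.sum_const,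
    G.card_neighborFinset_eq_degree, nsmul_eq_mul]
  rfl

lemma forestMean_mono {z : Sym2 (Option V) → ℝ} (hz : ∀ e, 0 ≤ z e) {h h' : (V → Option V) → ℝ}
    (hh : ∀ π, h π ≤ h' π) : forestMean z h ≤ forestMean z h' := by
  unfold forestMean
  refine div_le_div_of_nonneg_right (Finset.sum_le_sum fun π _ =>
    mul_le_mul_of_nonneg_left (hh _) (forestWeight_nonneg hz π))
    (Finset.sum_nonneg fun π _ => forestWeight_nonneg hz π)

lemma forestMean_affine {z : Sym2 (Option V) → ℝ} (hZ : 0 < ∑ π : Forest V, forestWeight z π)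
    (a b : ℝ) (h : (V → Option V) → ℝ) :
    forestMean z (fun π => a + b * h π) = a + b * forestMean z h := by
  unfold forestMean
  simp only [mul_add, Finset.sum_add_distrib, ← Finset.sum_mul]
  have h1 : ∑ π : Forest V, forestWeight z π * (b * h π.1) =
      b * ∑ π : Forest V, forestWeight z π * h π.1 := by
    rw [Finset.mul_sum]
    exact Finset.sum_congr rfl fun π _ => by ring
  rw [h1]
  field_simp

/-- Vertices with small degree or small total conductance. -/
def badVert (G : SimpleGraph V) [DecidableRel G.Adj] (d ε m : ℝ) (c : Sym2 V → ℝ) : Finset V :=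
  univ.filter fun v => (G.degree v : ℝ) < d ∨ wdeg G c v < (1 - ε) * (G.degree v * m)

/-- A second moment bound for the number of bad vertices. -/
def badBound (G : SimpleGraph V) [DecidableRel G.Adj] (d ε m : ℝ) (c : Sym2 V → ℝ) : ℝ :=
  ∑ v, if (G.degree v : ℝ) < d then 1 else
    (wdeg G c v - G.degree v * m) ^ 2 / (ε * (G.degree v * m)) ^ 2

lemma badBound_nonneg (G : SimpleGraph V) [DecidableRel G.Adj] (d ε m : ℝ) (c : Sym2 V → ℝ) :
    0 ≤ badBound G d ε m c :=
  Finset.sum_nonneg fun v _ => by split_ifs <;> positivity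

lemma card_badVert_le (G : SimpleGraph V) [DecidableRel G.Adj] {d ε m : ℝ} (hd : 0 < d)
    (hε : 0 < ε) (hm : 0 < m) (c : Sym2 V → ℝ) :
    ((badVert G d ε m c).card : ℝ) ≤ badBound G d ε m c := by
  unfold badVert badBound
  rw [Finset.card_filter, Nat.cast_sum]
  refine Finset.sum_le_sum fun v _ => ?_
  by_cases h1 : (G.degree v : ℝ) < d
  · simp [h1]
  · by_cases h2 : wdeg G c v < (1 - ε) * (G.degree v * m)
    · simp only [h1, h2, or_true, if_true, if_false, Nat.cast_one]
      have h3 : 0 < (G.degree v : ℝ) := by linarith [not_lt.1 h1]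
      have h4 : 0 < ε * (G.degree v * m) := by positivity
      rw [one_le_div (by positivity)]
      have h5 : ε * (G.degree v * m) ≤ G.degree v * m - wdeg G c v := by linarith
      nlinarith
    · simp only [h1, h2, or_self, if_false, Nat.cast_zero]
      positivity

lemma continuous_badBound (G : SimpleGraph V) [DecidableRel G.Adj] (d ε m β : ℝ) :
    Continuous fun u : Sym2 V → ℝ => badBound G d ε m (expW β u) := by
  unfold badBound
  refine continuous_finsetSum _ fun v _ => ?_
  split_ifs
  · exact continuous_const
  · exact (((continuous_wdeg G β v).sub continuous_const).pow 2).div_const _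

lemma integral_badBound_le (G : SimpleGraph V) [DecidableRel G.Adj] {d ε β : ℝ} (hd : 0 < d)
    (hε : 0 < ε) (hβ : 0 ≤ β) :
    ∫ u, badBound G d ε (meanW β) (expW β u) ∂(labelMeasure (Sym2 V)) ≤
      (univ.filter fun v => (G.degree v : ℝ) < d).card +
        Fintype.card V * (1 / (ε ^ 2 * (d * meanW β))) := by
  have hm := meanW_pos hβ
  unfold badBound
  rw [integral_finsetSum]
  · rw [Finset.card_filter, Nat.cast_sum, ← Finset.card_univ, ← nsmul_eq_mul, ← Finset.sum_const,
      ← Finset.sum_add_distrib]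
    refine Finset.sum_le_sum fun v _ => ?_
    by_cases h1 : (G.degree v : ℝ) < d
    · simp only [h1, if_true, integral_const, probReal_univ, smul_eq_mul, Nat.cast_one, mul_one]
      have : 0 ≤ 1 / (ε ^ 2 * (d * meanW β)) := by positivity
      linarith
    · simp only [h1, if_false, Nat.cast_zero, zero_add]
      have h3 : d ≤ (G.degree v : ℝ) := not_lt.1 h1
      have h4 : 0 < (G.degree v : ℝ) := by linarith
      rw [integral_div]
      calc _ ≤ G.degree v * meanW β / (ε * (G.degree v * meanW β)) ^ 2 := by
            gcongr; exact integral_wdeg_sq_le G hβ v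
        _ = 1 / (ε ^ 2 * (G.degree v * meanW β)) := by field_simp
        _ ≤ _ := by gcongr
  · intro v _
    refine integrable_labelMeasure ?_
    split_ifs
    · exact continuous_const
    · exact (((continuous_wdeg G β v).sub continuous_const).pow 2).div_const _

/-- Exponential sums averaged over possible sets of bad vertices. -/
def subsetSum (p g : V → Option V → ℝ) (y : (V → Option V) → ℝ) (s : ℝ) : ℝ :=
  ∑ B : Finset V, Real.exp (-s) ^ B.card * offSum p g y B

lemma sum_pow_card (x : ℝ) : ∑ B : Finset V, x ^ B.card = (1 + x) ^ Fintype.card V := by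
  have := Finset.prod_one_add (f := fun _ : V => x) (univ : Finset V)
  simp only [Finset.prod_const, Finset.card_univ, Finset.powerset_univ] at this
  exact this.symm

lemma integral_subsetSum_le {p : V → Option V → ℝ} (hp : ∀ v o, 0 ≤ p v o) {β : ℝ} (hβ : 0 ≤ β)
    (y : (V → Option V) → ℝ) (s : ℝ) :
    ∫ u, subsetSum p (normW (expW β u) (meanW β)) y s ∂(labelMeasure (Sym2 V)) ≤
      Real.exp (Fintype.card V * Real.exp (-s)) * prodMean p fun π => Real.exp (y π) := by
  unfold subsetSum
  rw [integral_finsetSum _ fun B _ => integrable_labelMeasure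
    ((continuous_offSum p β _ y B).const_mul _)]
  have h0 : 0 ≤ prodMean p fun π => Real.exp (y π) := Finset.sum_nonneg fun π _ =>
    mul_nonneg (Finset.prod_nonneg fun _ _ => hp _ _) (Real.exp_pos _).le
  calc _ ≤ ∑ B : Finset V, Real.exp (-s) ^ B.card * prodMean p fun π => Real.exp (y π) := by
        refine Finset.sum_le_sum fun B _ => ?_
        rw [integral_const_mul]
        exact mul_le_mul_of_nonneg_left (integral_offSum_le hp hβ y B) (by positivity)
    _ ≤ _ := by
        rw [← Finset.sum_mul, sum_pow_card, Real.exp_nat_mul]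
        refine mul_le_mul_of_nonneg_right ?_ h0
        refine pow_le_pow_left₀ (by positivity) ?_ _
        linarith [Real.add_one_le_exp (Real.exp (-s))]

lemma inv_one_sub_le_exp {ε : ℝ} (h0 : 0 ≤ ε) (h1 : ε ≤ 1 / 2) : (1 - ε)⁻¹ ≤ Real.exp (2 * ε) := by
  rw [inv_le_iff_one_le_mul₀ (by linarith)]
  have := Real.add_one_le_exp (2 * ε)
  nlinarith

/-- The error exponent per vertex in the comparison of the forest measure with independent steps. -/
def errExp (κ D ε δ s ℓ : ℝ) : ℝ :=
  (1 + κ) / κ * (2 / D + δ) + 2 * ℓ * δ + 2 * ε + s * δ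

lemma forestMean_le_pointwise {G : SimpleGraph V} [DecidableRel G.Adj] {c : Sym2 V → ℝ}
    (hc : ∀ e, 0 < c e) (hc1 : ∀ e, c e ≤ 1) (hdeg : ∀ v, 0 < G.degree v) {κ : ℝ} (hκ : 0 < κ)
    {d m ε δ s ℓ A : ℝ} (hd : 0 < d) (hm : 0 < m) (hε0 : 0 < ε) (hε : ε ≤ 1 / 2) (hδ : 0 < δ)
    (hs : 0 ≤ s) (hℓ : 0 ≤ ℓ) (hA : 0 ≤ A) {y : (V → Option V) → ℝ} (hy : HamLip ℓ y)
    (hyb : ∀ π, y π ≤ 2 * ℓ * Fintype.card V) :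
    forestMean (killW G c κ) y ≤ A +
      Real.exp (Fintype.card V * errExp κ (d * m) ε δ s ℓ - A) *
        subsetSum (srwStep G κ) (normW c m) y s + 2 * ℓ / δ * badBound G d ε m c := by
  have hz : ∀ e, 0 ≤ killW G c κ e := extW_nonneg (edgeW_nonneg G hc) fun v =>
    (mul_pos hκ (wdeg_pos hc (hdeg v))).le
  have hZ : 0 < ∑ π : Forest V, forestWeight (killW G c κ) π :=
    sum_forestWeight_pos (edgeW_nonneg G hc) fun v => mul_pos hκ (wdeg_pos hc (hdeg v))
  have hoff : ∀ B, 0 ≤ offSum (srwStep G κ) (normW c m) y B := by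
    refine offSum_nonneg (srwStep_nonneg G hκ) ?_ y
    rintro v (_ | u)
    · simp [normW]
    · exact div_nonneg (hc _).le hm.le
  have hsub : 0 ≤ subsetSum (srwStep G κ) (normW c m) y s :=
    Finset.sum_nonneg fun B _ => mul_nonneg (by positivity) (hoff B)
  have hbad := card_badVert_le G hd hε0 hm c
  have hbad0 := badBound_nonneg G d ε m c
  set B := badVert G d ε m c with hB
  set N : ℝ := (Fintype.card V : ℝ) with hN
  rcases le_or_gt (B.card : ℝ) (δ * N) with hcase | hcase
  · have h1 : forestMean (killW G c κ) y ≤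
        A + Real.exp (-A) * forestMean (killW G c κ) (fun π => Real.exp (y π)) := by
      rw [← forestMean_affine hZ]
      refine forestMean_mono hz fun π => ?_
      rw [← Real.exp_add]
      linarith [Real.add_one_le_exp (-A + y π)]
    have hnotB : ∀ v ∉ B, d ≤ G.degree v ∧ (1 - ε) * (G.degree v * m) ≤ wdeg G c v := by
      intro v hv
      simp only [hB, badVert, mem_filter, mem_univ, true_and, not_or, not_lt] at hv
      exact hv
    have h2 := forestMean_exp_le hc hc1 hdeg hκ B (M := d * m / 2) (by positivity) hm hε0.le
      (by linarith) (fun v hv => by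
        have ⟨h3, h4⟩ := hnotB v hv
        refine le_trans ?_ h4
        have h5 : d * m ≤ G.degree v * m := by gcongr
        have h6 : 0 < d * m := by positivity
        nlinarith) (fun v hv => (hnotB v hv).2) hy
    have h3 : Real.exp ((1 + κ) / κ * (N / (d * m / 2) + B.card)) *
        (Real.exp (2 * ℓ * B.card) * ((1 - ε)⁻¹) ^ Fintype.card V *
          offSum (srwStep G κ) (normW c m) y B) ≤
        Real.exp (N * errExp κ (d * m) ε δ s ℓ) *
          subsetSum (srwStep G κ) (normW c m) y s := by
      have h4 : offSum (srwStep G κ) (normW c m) y B ≤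
          Real.exp (s * B.card) * subsetSum (srwStep G κ) (normW c m) y s := by
        have h5 : Real.exp (-s) ^ B.card * offSum (srwStep G κ) (normW c m) y B ≤
            subsetSum (srwStep G κ) (normW c m) y s :=
          Finset.single_le_sum (f := fun B => Real.exp (-s) ^ B.card *
            offSum (srwStep G κ) (normW c m) y B)
            (fun B _ => mul_nonneg (by positivity) (hoff B)) (mem_univ B)
        have h6 := mul_le_mul_of_nonneg_left h5 (Real.exp_pos (s * B.card)).le
        rw [← mul_assoc, ← Real.exp_nat_mul, ← Real.exp_add] at h6
        have h7 : s * (B.card : ℝ) + B.card * -s = 0 := by ring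
        rwa [h7, Real.exp_zero, one_mul] at h6
      have h5 : ((1 - ε)⁻¹) ^ Fintype.card V ≤ Real.exp (N * (2 * ε)) := by
        rw [hN, Real.exp_nat_mul]
        exact pow_le_pow_left₀ (inv_nonneg.2 (by linarith)) (inv_one_sub_le_exp hε0.le hε) _
      have h6 : 0 ≤ (1 - ε)⁻¹ := inv_nonneg.2 (by linarith)
      calc _ ≤ Real.exp ((1 + κ) / κ * (N / (d * m / 2) + B.card)) *
          (Real.exp (2 * ℓ * B.card) * Real.exp (N * (2 * ε)) *
            (Real.exp (s * B.card) * subsetSum (srwStep G κ) (normW c m) y s)) := by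
            have := hoff B
            gcongr
        _ = Real.exp ((1 + κ) / κ * (N / (d * m / 2) + B.card) + 2 * ℓ * B.card + N * (2 * ε) +
              s * B.card) * subsetSum (srwStep G κ) (normW c m) y s := by
            simp only [Real.exp_add]; ring
        _ ≤ _ := by
            refine mul_le_mul_of_nonneg_right (Real.exp_le_exp.2 ?_) hsub
            unfold errExp
            have hk : 0 ≤ (1 + κ) / κ := by positivity
            have e1 : (1 + κ) / κ * (N / (d * m / 2) + B.card) ≤
                (1 + κ) / κ * (N / (d * m / 2) + δ * N) := by gcongr
            have e2 : 2 * ℓ * (B.card : ℝ) ≤ 2 * ℓ * (δ * N) := by gcongr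
            have e3 : s * (B.card : ℝ) ≤ s * (δ * N) := by gcongr
            have e4 : N / (d * m / 2) = N * (2 / (d * m)) := by field_simp
            rw [e4] at e1 ⊢
            linarith
    have h4 : Real.exp (-A) * forestMean (killW G c κ) (fun π => Real.exp (y π)) ≤
        Real.exp (N * errExp κ (d * m) ε δ s ℓ - A) *
          subsetSum (srwStep G κ) (normW c m) y s := by
      refine (mul_le_mul_of_nonneg_left (h2.trans h3) (Real.exp_pos _).le).trans_eq ?_
      rw [← mul_assoc, ← Real.exp_add]
      ring_nf
    have h5 : 0 ≤ 2 * ℓ / δ * badBound G d ε m c := by positivity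
    linarith
  · have h1 : forestMean (killW G c κ) y ≤ 2 * ℓ * N := by
      have h2 := forestMean_mono hz (h := y) (h' := fun π => 2 * ℓ * N + 0 * y π)
        fun π => by simpa using hyb π
      rw [forestMean_affine hZ] at h2
      simpa using h2
    have h2 : 2 * ℓ * N ≤ 2 * ℓ / δ * badBound G d ε m c := by
      calc 2 * ℓ * N = 2 * ℓ / δ * (δ * N) := by field_simp
        _ ≤ _ := by gcongr; linarith
    have h3 : 0 ≤ Real.exp (N * errExp κ (d * m) ε δ s ℓ - A) *
        subsetSum (srwStep G κ) (normW c m) y s := by positivity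
    linarith

/-- The annealed mean of a Lipschitz function of the killed forest is at most its mean under
independent steps, up to an explicit error. -/
lemma integral_forestMean_le {G : SimpleGraph V} [DecidableRel G.Adj] (hdeg : ∀ v, 0 < G.degree v)
    {κ d ε δ s L t β : ℝ} (hκ : 0 < κ) (hd : 0 < d) (hε0 : 0 < ε) (hε : ε ≤ 1 / 2) (hδ : 0 < δ)
    (hs : 0 ≤ s) (hL : 0 ≤ L) (ht : 0 < t) (htL : t * L ≤ 1) (hβ : 0 ≤ β)
    {h : (V → Option V) → ℝ} (hh : HamLip L h) :
    ∫ u, forestMean (killW G (expW β u) κ) h ∂(labelMeasure (Sym2 V)) ≤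
      prodMean (srwStep G κ) h + (1 / t) *
        (Fintype.card V * (errExp κ (d * meanW β) ε δ s (t * L) + Real.exp (-s) + (t * L) ^ 2) + 1 +
          2 * (t * L) / δ * ((univ.filter fun v => (G.degree v : ℝ) < d).card +
            Fintype.card V * (1 / (ε ^ 2 * (d * meanW β))))) := by
  have hm := meanW_pos hβ
  have hp0 := srwStep_nonneg G hκ
  have hp1 := fun v => sum_srwStep G hκ (hdeg v)
  set μ := prodMean (srwStep G κ) h with hμ
  set y : (V → Option V) → ℝ := fun π => -(t * μ) + t * h π with hydef
  have hylin : ∀ a b : ℝ, prodMean (srwStep G κ) (fun π => a + b * h π) = a + b * μ := by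
    intro a b
    unfold prodMean
    simp only [mul_add, Finset.sum_add_distrib, ← Finset.sum_mul, sum_prod_eq_one hp1, one_mul]
    rw [hμ, prodMean, Finset.mul_sum]
    congr 1
    exact Finset.sum_congr rfl fun π _ => by ring
  have hy : HamLip (t * L) y := by
    intro π v o
    have : y (Function.update π v o) - y π = t * (h (Function.update π v o) - h π) := by
      simp only [hydef]; ring
    rw [this, abs_mul, abs_of_pos ht]
    exact mul_le_mul_of_nonneg_left (hh π v o) ht.le
  have hymean : prodMean (srwStep G κ) y = 0 := by rw [hydef, hylin]; ring
  have hyb : ∀ π, y π ≤ 2 * (t * L) * Fintype.card V := by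
    intro π
    have h1 : ∀ π', h π - 2 * L * Fintype.card V ≤ h π' := fun π' => by
      linarith [(abs_le.1 (hh.abs_sub_le π π')).2]
    have h2 := prodMean_mono hp0 (Φ := fun π' => (h π - 2 * L * Fintype.card V) + 0 * h π')
      (Ψ := h) fun π' => by simpa using h1 π'
    rw [hylin, ← hμ] at h2
    simp only [hydef]
    nlinarith
  set N : ℝ := (Fintype.card V : ℝ) with hN
  set E := errExp κ (d * meanW β) ε δ s (t * L) with hE
  have hℓ0 : 0 ≤ t * L := by positivity
  have hE0 : 0 ≤ E := by
    have : 0 ≤ (1 + κ) / κ * (2 / (d * meanW β) + δ) := by positivity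
    have : 0 ≤ s * δ := by positivity
    have : 0 ≤ 2 * (t * L) * δ := by positivity
    rw [hE]; unfold errExp; linarith
  set A := N * (E + Real.exp (-s) + (t * L) ^ 2) with hA
  have hA0 : 0 ≤ A := by positivity
  set Q : (Sym2 V → ℝ) → ℝ := fun u =>
    subsetSum (srwStep G κ) (normW (expW β u) (meanW β)) y s with hQ
  have hQc : Continuous Q := continuous_finsetSum _ fun B _ =>
    (continuous_offSum _ β _ y B).const_mul _
  have hbc := continuous_badBound G d ε (meanW β) β
  have hpt : ∀ᵐ u ∂(labelMeasure (Sym2 V)), forestMean (killW G (expW β u) κ) h ≤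
      μ + (1 / t) * (A + Real.exp (N * E - A) * Q u +
        2 * (t * L) / δ * badBound G d ε (meanW β) (expW β u)) := by
    filter_upwards [ae_labelMeasure (ι := Sym2 V)] with u hu
    have hc : ∀ e, 0 < expW β u e := fun e => Real.exp_pos _
    have hc1 : ∀ e, expW β u e ≤ 1 := fun e =>
      Real.exp_le_one_iff.2 (by nlinarith [(hu e).1])
    have h1 := forestMean_le_pointwise hc hc1 hdeg hκ hd hm hε0 hε hδ hs hℓ0 hA0 hy hyb
    have hZ : 0 < ∑ π : Forest V, forestWeight (killW G (expW β u) κ) π :=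
      sum_forestWeight_pos (edgeW_nonneg G hc) fun v => mul_pos hκ (wdeg_pos hc (hdeg v))
    rw [hydef, forestMean_affine hZ, ← hydef] at h1
    rw [← sub_le_iff_le_add', one_div, inv_mul_eq_div, le_div_iff₀ ht]
    simp only [hQ]
    linarith
  have h_int := integral_mono_ae (integrable_labelMeasure (continuous_forestMean hdeg β hκ h))
    (integrable_labelMeasure (by fun_prop)) hpt
  refine h_int.trans ?_
  have i1 : Integrable (fun u => A + Real.exp (N * E - A) * Q u) (labelMeasure (Sym2 V)) :=
    integrable_labelMeasure (by fun_prop)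
  have i2 : Integrable (fun u => 2 * (t * L) / δ * badBound G d ε (meanW β) (expW β u))
      (labelMeasure (Sym2 V)) := integrable_labelMeasure (by fun_prop)
  rw [integral_add (integrable_const _) (integrable_labelMeasure (by fun_prop)), integral_const_mul,
    integral_add i1 i2, integral_add (integrable_const _) (integrable_labelMeasure (by fun_prop)),
    integral_const_mul, integral_const_mul]
  simp only [integral_const, probReal_univ, smul_eq_mul, one_mul]
  have hQi : Real.exp (N * E - A) * ∫ u, Q u ∂(labelMeasure (Sym2 V)) ≤ 1 := by
    have h1 := integral_subsetSum_le hp0 hβ y s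
    have h2 := prodMean_exp_le hp0 hp1 htL hy
    rw [hymean] at h2
    calc _ ≤ Real.exp (N * E - A) * (Real.exp (N * Real.exp (-s)) *
          Real.exp (0 + N * (t * L) ^ 2)) := by
          refine mul_le_mul_of_nonneg_left (h1.trans ?_) (Real.exp_pos _).le
          exact mul_le_mul_of_nonneg_left h2 (Real.exp_pos _).le
      _ = 1 := by
          rw [← Real.exp_add, ← Real.exp_add, Real.exp_eq_one_iff, hA]
          ring
  have hb := integral_badBound_le G hd hε0 hβ
  have hb' := mul_le_mul_of_nonneg_left hb (show 0 ≤ 2 * (t * L) / δ by positivity)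
  rw [← integral_const_mul] at hb'
  gcongr

/-- The error per vertex in the comparison of the killed forest with independent steps. -/
def errRate (κ ε δ s L t a b c : ℝ) : ℝ :=
  (1 / t) * ((1 + κ) / κ * (2 * a + δ) + 2 * (t * L) * δ + 2 * ε + s * δ + Real.exp (-s) +
    (t * L) ^ 2 + b + 2 * (t * L) / δ * (c + a / ε ^ 2))

lemma integral_forestMean_le_errRate {G : SimpleGraph V} [DecidableRel G.Adj]
    (hdeg : ∀ v, 0 < G.degree v) {κ d ε δ s L t β a b c : ℝ} (hκ : 0 < κ) (hd : 0 < d)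
    (hε0 : 0 < ε) (hε : ε ≤ 1 / 2) (hδ : 0 < δ) (hs : 0 ≤ s) (hL : 0 ≤ L) (ht : 0 < t)
    (htL : t * L ≤ 1) (hβ : 0 ≤ β) (ha : (1 + β) / d ≤ a) (hb : 1 ≤ Fintype.card V * b)
    (hc : ((univ.filter fun v => (G.degree v : ℝ) < d).card : ℝ) ≤ Fintype.card V * c)
    {h : (V → Option V) → ℝ} (hh : HamLip L h) :
    ∫ u, forestMean (killW G (expW β u) κ) h ∂(labelMeasure (Sym2 V)) ≤
      prodMean (srwStep G κ) h + Fintype.card V * errRate κ ε δ s L t a b c := by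
  refine (integral_forestMean_le hdeg hκ hd hε0 hε hδ hs hL ht htL hβ hh).trans ?_
  have hm := meanW_pos hβ
  have ha' : 1 / (d * meanW β) ≤ a := by
    refine le_trans ?_ ha
    rw [div_le_div_iff₀ (by positivity) hd]
    have := (div_le_iff₀ (by positivity : 0 < 1 + β)).1 (meanW_ge hβ)
    nlinarith
  set N : ℝ := (Fintype.card V : ℝ) with hN
  have hN0 : 0 ≤ N := Nat.cast_nonneg _
  have h1 : 1 / (ε ^ 2 * (d * meanW β)) ≤ a / ε ^ 2 := by
    rw [div_mul_eq_div_div_swap]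
    gcongr
  have h2 : errExp κ (d * meanW β) ε δ s (t * L) ≤
      (1 + κ) / κ * (2 * a + δ) + 2 * (t * L) * δ + 2 * ε + s * δ := by
    unfold errExp
    have : 2 / (d * meanW β) ≤ 2 * a := by
      rw [← mul_one_div]; gcongr
    gcongr
  have h3 : 2 * (t * L) / δ * (((univ.filter fun v => (G.degree v : ℝ) < d).card : ℝ) +
      N * (1 / (ε ^ 2 * (d * meanW β)))) ≤ 2 * (t * L) / δ * (N * c + N * (a / ε ^ 2)) := by
    gcongr
  have h4 := mul_le_mul_of_nonneg_left h2 hN0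
  calc _ ≤ prodMean (srwStep G κ) h + (1 / t) *
        (N * (((1 + κ) / κ * (2 * a + δ) + 2 * (t * L) * δ + 2 * ε + s * δ) + Real.exp (-s) +
          (t * L) ^ 2) + N * b + 2 * (t * L) / δ * (N * c + N * (a / ε ^ 2))) := by
        gcongr
    _ = _ := by unfold errRate; ring

lemma exists_errRate_le {κ L θ : ℝ} (hκ : 0 < κ) (hL : 0 < L) (hθ : 0 < θ) :
    ∃ ε δ s t : ℝ, 0 < ε ∧ ε ≤ 1 / 2 ∧ 0 < δ ∧ 0 ≤ s ∧ 0 < t ∧ t * L ≤ 1 ∧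
      errRate κ ε δ s L t 0 0 0 < θ := by
  set t := min (1 / L) (θ / (8 * L ^ 2)) with ht
  have ht0 : 0 < t := by positivity
  have ht1 : t * L ≤ 1 := (le_div_iff₀ hL).1 (min_le_left _ _)
  have ht2 : t * (8 * L ^ 2) ≤ θ := (le_div_iff₀ (by positivity)).1 (min_le_right _ _)
  set s := 8 / (t * θ) with hs
  have hs0 : 0 < s := by positivity
  set ε := min (1 / 2) (t * θ / 16) with hε
  have hε0 : 0 < ε := by positivity
  have hε1 : ε ≤ t * θ / 16 := min_le_right _ _
  set M := (1 + κ) / κ + 2 * (t * L) + s with hM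
  have hM0 : 0 < M := by positivity
  set δ := t * θ / (8 * M) with hδ
  have hδ0 : 0 < δ := by positivity
  have hδM : M * δ = t * θ / 8 := by rw [hδ]; field_simp
  have hexp : Real.exp (-s) ≤ t * θ / 8 := by
    have h1 : s ≤ Real.exp s := by linarith [Real.add_one_le_exp s]
    rw [Real.exp_neg]
    calc (Real.exp s)⁻¹ ≤ s⁻¹ := inv_anti₀ hs0 h1
      _ = t * θ / 8 := by rw [hs, inv_div]
  refine ⟨ε, δ, s, t, hε0, min_le_left _ _, hδ0, hs0.le, ht0, ht1, ?_⟩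
  have hsq : (t * L) ^ 2 ≤ t * θ / 8 := by nlinarith
  have htθ : 0 < t * θ := by positivity
  unfold errRate
  rw [one_div, inv_mul_eq_div, div_lt_iff₀ ht0]
  have : (1 + κ) / κ * (2 * 0 + δ) + 2 * (t * L) * δ + s * δ = M * δ := by rw [hM]; ring
  simp only [zero_div, add_zero, mul_zero, zero_add] at this ⊢
  linarith

lemma prodMean_const {p : V → Option V → ℝ} (hp : ∀ v, ∑ o, p v o = 1) (a : ℝ) :
    prodMean p (fun _ => a) = a := by
  unfold prodMean
  rw [← Finset.sum_mul, sum_prod_eq_one hp, one_mul]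

lemma prodMean_card_roots {p : V → Option V → ℝ} (hp : ∀ v, ∑ o, p v o = 1) :
    prodMean p (fun π => ((roots π).card : ℝ)) = ∑ v, p v none := by
  have h1 : prodMean p (fun π => ((roots π).card : ℝ)) =
      ∑ v, prodMean p (fun π => if π v = none then 1 else 0) := by
    unfold prodMean
    rw [Finset.sum_comm]
    refine Finset.sum_congr rfl fun π _ => ?_
    rw [← Finset.mul_sum, Finset.sum_boole]
    rfl
  rw [h1]
  refine Finset.sum_congr rfl fun v _ => ?_
  rw [← prodMean_avg hp v]
  simp only [Function.update_self, mul_ite, mul_one, mul_zero, Finset.sum_ite_eq', mem_univ,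
    if_true]
  exact prodMean_const hp _

lemma prodMean_srwStep_card_roots_le {G : SimpleGraph V} [DecidableRel G.Adj]
    (hdeg : ∀ v, 0 < G.degree v) {κ : ℝ} (hκ : 0 < κ) :
    prodMean (srwStep G κ) (fun π => ((roots π).card : ℝ)) ≤ Fintype.card V * κ := by
  rw [prodMean_card_roots fun v => sum_srwStep G hκ (hdeg v)]
  simp only [srwStep, Option.elim, Finset.sum_const, nsmul_eq_mul, Finset.card_univ]
  gcongr
  exact div_le_self hκ.le (by linarith)

lemma treeMean_le_forestMean {G : SimpleGraph V} (hG : G.Connected) {c : Sym2 V → ℝ}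
    (hc : ∀ e, 0 < c e) {k : V → ℝ} (hk : ∀ v, 0 < k v) {f : Finset (Sym2 V) → ℝ} {L : ℝ}
    (hL : 0 ≤ L) (hf : ∀ e S, |f (insert e S) - f S| ≤ L) :
    treeMean G c f ≤ forestMean (extW (edgeW G c) k) (fun π => f (inner (forestEdges π))) +
      L * forestMean (extW (edgeW G c) k) (fun π => ((roots π).card : ℝ)) := by
  have h1 := forestMean_le_treeMean hG hc hk (f := fun S => -f S) hL fun e S => by
    linarith [(abs_le.1 (hf e S)).2]
  have h2 : treeMean G c (fun S => -f S) = -treeMean G c f := by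
    simp [treeMean, Finset.sum_neg_distrib, neg_div]
  have h3 : forestMean (extW (edgeW G c) k) (fun π => -f (inner (forestEdges π))) =
      -forestMean (extW (edgeW G c) k) (fun π => f (inner (forestEdges π))) := by
    simp [forestMean, Finset.sum_neg_distrib, neg_div]
  rw [h2, h3] at h1
  linarith

lemma integral_treeMean_le {G : SimpleGraph V} [DecidableRel G.Adj] (hG : G.Connected)
    (hdeg : ∀ v, 0 < G.degree v) {κ β Λ R : ℝ} (hκ : 0 < κ) (hΛ : 1 ≤ 2 * Λ)
    (hR : ∀ h : (V → Option V) → ℝ, HamLip (2 * Λ) h →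
      ∫ u, forestMean (killW G (expW β u) κ) h ∂(labelMeasure (Sym2 V)) ≤
        prodMean (srwStep G κ) h + Fintype.card V * R)
    {f : Finset (Sym2 V) → ℝ} (hf : ∀ e S, |f (insert e S) - f S| ≤ Λ) :
    ∫ u, treeMean G (expW β u) f ∂(labelMeasure (Sym2 V)) ≤
      prodMean (srwStep G κ) (fun π => f (inner (forestEdges π))) +
        Fintype.card V * (Λ * κ + (1 + Λ) * R) := by
  have hΛ0 : 0 ≤ Λ := by linarith
  have hpt : ∀ u, treeMean G (expW β u) f ≤
      forestMean (killW G (expW β u) κ) (fun π => f (inner (forestEdges π))) +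
        Λ * forestMean (killW G (expW β u) κ) (fun π => ((roots π).card : ℝ)) := fun u =>
    treeMean_le_forestMean hG (fun e => Real.exp_pos _)
      (fun v => mul_pos hκ (wdeg_pos (fun e => Real.exp_pos _) (hdeg v))) hΛ0 hf
  have i1 := integrable_labelMeasure
    (continuous_forestMean hdeg β hκ (fun π => f (inner (forestEdges π))))
  have i2 := (integrable_labelMeasure
    (continuous_forestMean hdeg β hκ (fun π => ((roots π).card : ℝ)))).const_mul Λ
  have h1 := integral_mono (integrable_labelMeasure (continuous_treeMean hG β f)) (i1.add i2) hpt
  simp only [Pi.add_apply] at h1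
  rw [integral_add i1 i2, integral_const_mul] at h1
  have h2 := hR _ (hamLip_of_insert hΛ0 hf)
  have h3 := hR (fun π => ((roots π).card : ℝ)) fun π v o => (hamLip_card_roots π v o).trans hΛ
  have h4 := mul_le_mul_of_nonneg_left
    (h3.trans (add_le_add_left (prodMean_srwStep_card_roots_le hdeg hκ) _)) hΛ0
  linarith

lemma abs_wstBetaBallProb_sub_le {G : SimpleGraph V} [DecidableRel G.Adj] (hG : G.Connected)
    (hdeg : ∀ v, 0 < G.degree v) {κ β R : ℝ} (hκ : 0 < κ) (r : ℕ) {m : ℕ}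
    (H : SimpleGraph (Fin m)) (w : Fin m)
    (hR : ∀ h : (V → Option V) → ℝ, HamLip (2 * (2 * ((m : ℝ) + 1) ^ r)) h →
      ∫ u, forestMean (killW G (expW β u) κ) h ∂(labelMeasure (Sym2 V)) ≤
        prodMean (srwStep G κ) h + Fintype.card V * R) :
    |wstBetaBallProb G β r H w - (Fintype.card V : ℝ)⁻¹ *
        prodMean (srwStep G κ) (fun π => ballCount r H w (inner (forestEdges π)))| ≤
      2 * ((m : ℝ) + 1) ^ r * κ + (1 + 2 * ((m : ℝ) + 1) ^ r) * R := by
  set Λ : ℝ := 2 * ((m : ℝ) + 1) ^ r with hΛ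
  have hpow : (1 : ℝ) ≤ ((m : ℝ) + 1) ^ r := one_le_pow₀ (by linarith [Nat.cast_nonneg (α := ℝ) m])
  have hΛ1 : 1 ≤ 2 * Λ := by linarith
  have hf := ballCount_insert (V := V) r H w
  have h1 := integral_treeMean_le hG hdeg hκ hΛ1 hR hf
  have h2 := integral_treeMean_le hG hdeg hκ hΛ1 hR (f := fun S => -ballCount r H w S)
    fun e S => by
      rw [← neg_add', abs_neg, ← sub_eq_add_neg]
      exact hf e S
  have h3 : ∀ c, treeMean G c (fun S => -ballCount r H w S) = -treeMean G c (ballCount r H w) :=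
    fun c => by simp [treeMean, Finset.sum_neg_distrib, neg_div]
  have h4 : prodMean (srwStep G κ) (fun π => -ballCount r H w (inner (forestEdges π))) =
      -prodMean (srwStep G κ) (fun π => ballCount r H w (inner (forestEdges π))) := by
    simp [prodMean, Finset.sum_neg_distrib]
  simp only [h3, integral_neg] at h2
  rw [h4] at h2
  have h5 : wstBetaBallProb G β r H w = (Fintype.card V : ℝ)⁻¹ *
      ∫ u, treeMean G (expW β u) (ballCount r H w) ∂(labelMeasure (Sym2 V)) := by
    rw [wstBetaBallProb, ← integral_const_mul]
    exact integral_congr_ae (Eventually.of_forall fun u => wstBallProb_eq G _ r H w)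
  have := hG.nonempty
  have hN : (0 : ℝ) < Fintype.card V := by exact_mod_cast Fintype.card_pos
  rw [h5, ← mul_sub, abs_mul, abs_of_pos (inv_pos.2 hN), inv_mul_le_iff₀ hN, abs_le]
  constructor <;> linarith

lemma wstBetaBallProb_zero (G : SimpleGraph V) (r : ℕ) {m : ℕ} (H : SimpleGraph (Fin m))
    (w : Fin m) : wstBetaBallProb G 0 r H w = wstBallProb G (fun _ => (1 : ℝ)) r H w := by
  simp [wstBetaBallProb]

/-- Uniformly over the strength of the disorder, the ball probabilities are close to those of the
graph spanned by independent killed random walk steps. -/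
lemma exists_eventually_abs_wstBetaBallProb_sub_le
    {V : ℕ → Type} [∀ n, Fintype (V n)] [∀ n, DecidableEq (V n)]
    {G : ∀ n, SimpleGraph (V n)} [∀ n, DecidableRel (G n).Adj] {d : ℕ → ℝ}
    (hconn : ∀ n, (G n).Connected) (hd : Tendsto d atTop atTop) {ε : ℕ → ℝ}
    (hε : Tendsto ε atTop (nhds 0))
    (hlow : ∀ n, ((univ.filter fun v : V n => ((G n).degree v : ℝ) < d n).card : ℝ) ≤
      Fintype.card (V n) * ε n)
    (r : ℕ) {m : ℕ} (H : SimpleGraph (Fin m)) (w : Fin m) {η : ℝ} (hη : 0 < η) :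
    ∃ κ : ℝ, ∀ β : ℕ → ℝ, (∀ n, 0 ≤ β n) → Tendsto (fun n => β n / d n) atTop (nhds 0) →
      ∀ᶠ n in atTop, |wstBetaBallProb (G n) (β n) r H w - (Fintype.card (V n) : ℝ)⁻¹ *
        prodMean (srwStep (G n) κ) (fun π => ballCount r H w (inner (forestEdges π)))| ≤ η := by
  set Λ : ℝ := 2 * ((m : ℝ) + 1) ^ r with hΛ
  have hΛ0 : 0 < Λ := by positivity
  refine ⟨η / (2 * Λ), fun β hβ0 hβd => ?_⟩
  set κ := η / (2 * Λ) with hκd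
  have hκ : 0 < κ := by positivity
  obtain ⟨e, δ, s, t, he0, he, hδ, hs, ht, htL, hrate⟩ :=
    exists_errRate_le hκ (show 0 < 2 * Λ by positivity)
      (show 0 < η / (2 * (1 + Λ)) by positivity)
  have hinv : Tendsto (fun n => (d n)⁻¹) atTop (nhds 0) := tendsto_inv_atTop_zero.comp hd
  have ha : Tendsto (fun n => (d n)⁻¹ + β n / d n) atTop (nhds 0) := by
    simpa using hinv.add hβd
  have hlim : Tendsto (fun n => errRate κ e δ s (2 * Λ) t ((d n)⁻¹ + β n / d n) (d n)⁻¹ (ε n))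
      atTop (nhds (errRate κ e δ s (2 * Λ) t 0 0 0)) := by
    unfold errRate
    exact (((((((((ha.const_mul 2).add_const δ).const_mul _).add_const _).add_const _).add_const
      _).add_const _).add_const _).add hinv |>.add ((hε.add (ha.div_const _)).const_mul _)).const_mul _
  filter_upwards [hlim.eventually_lt_const hrate, hd.eventually_gt_atTop 0,
    hε.eventually_lt_const one_pos] with n hn hdn hεn
  have hne := (hconn n).nonempty
  have hN : (0 : ℝ) < Fintype.card (V n) := by exact_mod_cast Fintype.card_pos
  obtain ⟨v, hv⟩ : ∃ v, d n ≤ ((G n).degree v : ℝ) := by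
    by_contra! hcon
    have h1 := hlow n
    rw [Finset.filter_true_of_mem fun v _ => hcon v, Finset.card_univ] at h1
    nlinarith
  have hvc : ((G n).degree v : ℝ) ≤ Fintype.card (V n) := by
    exact_mod_cast ((G n).degree_lt_card_verts v).le
  have hnt : Nontrivial (V n) := by
    have h1 : 0 < (G n).degree v := by exact_mod_cast hdn.trans_le hv
    obtain ⟨x, hx⟩ := ((G n).degree_pos_iff_exists_adj v).1 h1
    exact ⟨v, x, hx.ne⟩
  have hdeg : ∀ x, 0 < (G n).degree x := fun x =>
    (hconn n).preconnected.degree_pos_of_nontrivial x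
  have h1 := abs_wstBetaBallProb_sub_le (hconn n) hdeg hκ r H w
    fun h hh => integral_forestMean_le_errRate hdeg hκ hdn he0 he hδ hs (by positivity) ht htL
      (hβ0 n) (a := (d n)⁻¹ + β n / d n) (b := (d n)⁻¹) (by rw [add_div, one_div])
      (by rw [← div_eq_mul_inv, le_div_iff₀ hdn]; linarith) (hlow n) hh
  refine h1.trans ?_
  rw [← hΛ]
  have h2 : Λ * κ = η / 2 := by rw [hκd]; field_simp
  have h3 : (1 + Λ) * (η / (2 * (1 + Λ))) = η / 2 := by field_simp
  have h4 := mul_le_mul_of_nonneg_left hn.le (show 0 ≤ 1 + Λ by positivity)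
  linarith

/-- Let `Gₙ` be a high degree almost balanced sequence of simple connected
graphs with parameters `dₙ → ∞` and `K > 1` such that the local limit of `UST(Gₙ)` exists
(with ball-probability limits `L`).  If `βₙ ≪ dₙ`, then the local limit of `WST^{βₙ}(Gₙ)`
exists and equals the local limit of `UST(Gₙ)`. -/
theorem local_limit_wst_beta_eq_ust
    (V : ℕ → Type) [∀ n, Fintype (V n)] [∀ n, DecidableEq (V n)]
    (G : ∀ n, SimpleGraph (V n)) [∀ n, DecidableRel (G n).Adj]
    (d : ℕ → ℝ) (K : ℝ) (β : ℕ → ℝ)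
    (hconn : ∀ n, (G n).Connected)
    (hK : 1 < K)
    (hd : Tendsto d atTop atTop)
    -- (1 - o(1))|V(Gₙ)| of the vertices have degree in [dₙ, K dₙ]
    (htyp : ∃ ε : ℕ → ℝ, Tendsto ε atTop (nhds 0) ∧ ∀ n,
      (((Finset.univ.filter fun v : V n =>
          ((G n).degree v : ℝ) ∈ Set.Icc (d n) (K * d n)).card : ℝ))
        ≥ (1 - ε n) * (Fintype.card (V n) : ℝ))
    -- the total degree of atypical vertices is o(1)·dₙ·|V(Gₙ)|
    (hatyp : (fun n => ∑ v ∈ Finset.univ.filter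
        (fun v : V n => ((G n).degree v : ℝ) ∉ Set.Icc (d n) (K * d n)),
          ((G n).degree v : ℝ))
      =o[atTop] fun n => d n * (Fintype.card (V n) : ℝ))
    -- βₙ ≥ 0 and βₙ ≪ dₙ
    (hβ0 : ∀ n, 0 ≤ β n)
    (hβd : Tendsto (fun n => β n / d n) atTop (nhds 0))
    -- the local limit of UST(Gₙ) exists, with ball-probability limits L
    (L : ∀ m : ℕ, SimpleGraph (Fin m) → Fin m → ℕ → ℝ)
    (hUST : ∀ (m : ℕ) (H : SimpleGraph (Fin m)) (w : Fin m) (r : ℕ),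
      Tendsto (fun n => wstBallProb (G n) (fun _ => (1:ℝ)) r H w) atTop (nhds (L m H w r))) :
    ∀ (m : ℕ) (H : SimpleGraph (Fin m)) (w : Fin m) (r : ℕ),
      Tendsto (fun n => wstBetaBallProb (G n) (β n) r H w) atTop (nhds (L m H w r)) := by
  intro m H w r
  obtain ⟨ε, hε, htyp⟩ := htyp
  have hlow : ∀ n, ((univ.filter fun v : V n => ((G n).degree v : ℝ) < d n).card : ℝ) ≤
      Fintype.card (V n) * ε n := by
    intro n
    have h1 : (univ.filter fun v : V n => ((G n).degree v : ℝ) < d n).card +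
        (univ.filter fun v : V n => ((G n).degree v : ℝ) ∈ Set.Icc (d n) (K * d n)).card ≤
        Fintype.card (V n) := by
      rw [← Finset.card_union_of_disjoint]
      · exact Finset.card_le_univ _
      · refine Finset.disjoint_filter.2 fun v _ hv hv' => ?_
        exact absurd hv'.1 (not_le.2 hv)
    have h2 : ((univ.filter fun v : V n => ((G n).degree v : ℝ) < d n).card : ℝ) +
        (univ.filter fun v : V n => ((G n).degree v : ℝ) ∈ Set.Icc (d n) (K * d n)).card ≤
        Fintype.card (V n) := by exact_mod_cast h1
    have h3 := htyp n
    linarith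
  rw [Metric.tendsto_nhds]
  intro η hη
  obtain ⟨κ, hκ⟩ := exists_eventually_abs_wstBetaBallProb_sub_le hconn hd hε hlow r H w
    (show 0 < η / 4 by positivity)
  filter_upwards [hκ β hβ0 hβd, hκ (fun _ => 0) (fun _ => le_rfl) (by simp),
    Metric.tendsto_nhds.1 (hUST m H w r) (η / 4) (by positivity)] with n h1 h2 h3
  rw [wstBetaBallProb_zero] at h2
  rw [Real.dist_eq] at h3 ⊢
  rw [abs_le] at h1 h2
  rw [abs_lt] at h3 ⊢
  constructor <;> linarith [h1.1, h1.2, h2.1, h2.2, h3.1, h3.2]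

end WSTPaper
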